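/- For a commutative semigroup variety V, the following conditions are equivalent: (a) V is both a modular and an upper-modular element of the lattice Com; (b) V is a costandard element of the lattice Com; (c) either V = COM, or V = M ∨ N where M is one of the varieties T or SL and N is a commutative semigroup variety satisfying the identities x²yz = 0 and x²y = xy². -/

import Mathlib

/-!
Formalization framework: semigroup varieties as Galois-closed equational theories
over the free semigroup on countably many letters.  A variety is represented by
its equational theory; the order `V ≤ W` ("V is a subvariety of W") is reverse
inclusion of theories.  `Com` is the lattice of commutative semigroup varieties,
realized as the subtype of varieties whose theory contains the commutative law.
-/

open FreeSemigroup

/-- Words: elements of the free semigroup over a countably infinite alphabet. -/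
abbrev Word : Type := FreeSemigroup ℕ

/-- A semigroup identity `u = v`. -/
abbrev SgId : Type := Word × Word

/-- `spow a n = a ^ (n + 1)` in any (multiplicative) semigroup. -/
def spow {M : Type*} [Mul M] (a : M) : ℕ → M
  | 0 => a
  | n + 1 => a * spow a n

/-- A semigroup `S` satisfies the identity `e.1 = e.2`. -/
def SatS (S : Type) [Semigroup S] (e : SgId) : Prop :=
  ∀ σ : ℕ → S, FreeSemigroup.lift σ e.1 = FreeSemigroup.lift σ e.2

/-- `S` is a model of the set of identities `E`. -/
def Models (S : Type) [Semigroup S] (E : Set SgId) : Prop :=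
  ∀ e ∈ E, SatS S e

/-- The equational theory generated by `E`: all identities holding in every
model of `E` (by Birkhoff's theorem this is exactly deductive closure). -/
def eqTh (E : Set SgId) : Set SgId :=
  { e | ∀ (S : Type) [Semigroup S], Models S E → SatS S e }

theorem subset_eqTh (E : Set SgId) : E ⊆ eqTh E := by
  intro e he S _ hS
  exact hS e he

theorem eqTh_mono {E F : Set SgId} (h : E ⊆ F) : eqTh E ⊆ eqTh F := by
  intro e he S _ hS
  exact he S fun e' he' => hS e' (h he')

theorem eqTh_idem (E : Set SgId) : eqTh (eqTh E) = eqTh E := by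
  refine Set.Subset.antisymm ?_ (subset_eqTh _)
  intro e he S _ hS
  exact he S fun e' he' => he' S hS

/-- A semigroup variety, given by its (Galois-closed) equational theory. -/
structure SgVariety where
  th : Set SgId
  closed : eqTh th = th

theorem SgVariety.ext' {V W : SgVariety} (h : V.th = W.th) : V = W := by
  cases V; cases W; cases h; rfl

/-- The variety defined by a set of identities. -/
def varOf (E : Set SgId) : SgVariety :=
  ⟨eqTh E, eqTh_idem E⟩

/-- `V ≤ W` iff `V` is a subvariety of `W`, i.e. the theory of `W` is contained
in the theory of `V`. -/
instance : PartialOrder SgVariety where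
  le V W := W.th ⊆ V.th
  le_refl V := Set.Subset.refl _
  le_trans a b c h1 h2 := Set.Subset.trans h2 h1
  le_antisymm a b h1 h2 := SgVariety.ext' (Set.Subset.antisymm h2 h1)

/-- The lattice **SEM** of all semigroup varieties: join is intersection of
theories; meet is the variety defined by the union of the theories. -/
instance : Lattice SgVariety :=
  { (inferInstance : PartialOrder SgVariety) with
    sup := fun V W =>
      ⟨V.th ∩ W.th, by
        refine Set.Subset.antisymm (Set.subset_inter ?_ ?_) (subset_eqTh _)
        · exact (eqTh_mono Set.inter_subset_left).trans (le_of_eq V.closed)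
        · exact (eqTh_mono Set.inter_subset_right).trans (le_of_eq W.closed)⟩
    le_sup_left := fun V W => Set.inter_subset_left
    le_sup_right := fun V W => Set.inter_subset_right
    sup_le := fun V W U h1 h2 => Set.subset_inter h1 h2
    inf := fun V W => varOf (V.th ∪ W.th)
    inf_le_left := fun V W => Set.subset_union_left.trans (subset_eqTh _)
    inf_le_right := fun V W => Set.subset_union_right.trans (subset_eqTh _)
    le_inf := fun U V W h1 h2 =>
      (eqTh_mono (Set.union_subset h1 h2)).trans (le_of_eq U.closed) }

/-- The letters `x`, `y`, `z`. -/
def xw : Word := FreeSemigroup.of 0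
def yw : Word := FreeSemigroup.of 1
def zw : Word := FreeSemigroup.of 2

/-- The commutative law `xy = yx`. -/
def commId : SgId := (xw * yw, yw * xw)

/-- The lattice **Com**: commutative semigroup varieties. -/
abbrev ComVariety : Type := { V : SgVariety // commId ∈ V.th }

instance : Lattice ComVariety :=
  { (inferInstance : PartialOrder ComVariety) with
    sup := fun V W => ⟨V.1 ⊔ W.1, ⟨V.2, W.2⟩⟩
    le_sup_left := fun V W => @le_sup_left SgVariety _ V.1 W.1
    le_sup_right := fun V W => @le_sup_right SgVariety _ V.1 W.1
    sup_le := fun V W U h1 h2 => @sup_le SgVariety _ V.1 W.1 U.1 h1 h2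
    inf := fun V W => ⟨V.1 ⊓ W.1, subset_eqTh _ (Set.mem_union_left _ V.2)⟩
    inf_le_left := fun V W => @inf_le_left SgVariety _ V.1 W.1
    inf_le_right := fun V W => @inf_le_right SgVariety _ V.1 W.1
    le_inf := fun U V W h1 h2 => @le_inf SgVariety _ U.1 V.1 W.1 h1 h2 }

/-- The trivial variety `T`. -/
def trivialVar : SgVariety := varOf Set.univ

/-- The variety `COM` of all commutative semigroups. -/
def COMvar : SgVariety := varOf {commId}

/-- The variety `SL` of semilattices. -/
def SLvar : SgVariety := varOf {commId, (xw * xw, xw)}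

/-- `C_m = var{xᵐ = xᵐ⁺¹, xy = yx}` for `m ≥ 1`, and `C_0 = T`. -/
def Cvar : ℕ → SgVariety
  | 0 => trivialVar
  | m + 1 => varOf {commId, (spow xw m, spow xw (m + 1))}

def Tcom : ComVariety := ⟨trivialVar, subset_eqTh _ (Set.mem_univ _)⟩
def COMcom : ComVariety := ⟨COMvar, subset_eqTh _ rfl⟩
def SLcom : ComVariety := ⟨SLvar, subset_eqTh _ (Set.mem_insert _ _)⟩
def Ccom (m : ℕ) : ComVariety :=
  ⟨Cvar m, by
    cases m with
    | zero => exact subset_eqTh _ (Set.mem_univ _)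
    | succ m => exact subset_eqTh _ (Set.mem_insert _ _)⟩

/-- A semigroup (nonempty, with the given multiplication) is a group. -/
def IsGroupS (S : Type) [Semigroup S] : Prop :=
  ∃ e : S, (∀ a : S, e * a = a ∧ a * e = a) ∧ ∀ a : S, ∃ b : S, a * b = e ∧ b * a = e

/-- A nilsemigroup: there is a zero element and some power of every element is zero. -/
def IsNilS (S : Type) [Semigroup S] : Prop :=
  ∃ z : S, (∀ a : S, z * a = z ∧ a * z = z) ∧ ∀ a : S, ∃ n : ℕ, spow a n = z

/-- A group variety: all its (nonempty) members are groups. -/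
def IsGroupVariety (V : SgVariety) : Prop :=
  ∀ (S : Type) [Semigroup S], Nonempty S → Models S V.th → IsGroupS S

/-- A nil-variety: all its (nonempty) members are nilsemigroups. -/
def IsNilVariety (V : SgVariety) : Prop :=
  ∀ (S : Type) [Semigroup S], Nonempty S → Models S V.th → IsNilS S

/-- A combinatorial variety: all groups in it are singletons. -/
def IsCombinatorial (V : SgVariety) : Prop :=
  ∀ (S : Type) [Semigroup S], Models S V.th → IsGroupS S → Subsingleton S

/-- A periodic variety: satisfies `xⁿ = xⁿ⁺ᵏ` for some `n, k ≥ 1`. -/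
def IsPeriodic (V : SgVariety) : Prop :=
  ∃ n k : ℕ, (spow xw n, spow xw (n + k + 1)) ∈ V.th

/-- The letter `k` occurs in the word `w`. -/
def occursIn (k : ℕ) (w : Word) : Prop := k = w.head ∨ k ∈ w.tail

/-- `S` satisfies the identity `w = 0` (i.e. the system `wx = xw = w`, `x` fresh):
every value of `w` in `S` is a (two-sided) zero element. -/
def SatZeroS (S : Type) [Semigroup S] (w : Word) : Prop :=
  ∀ (σ : ℕ → S) (a : S),
    FreeSemigroup.lift σ w * a = FreeSemigroup.lift σ w ∧
      a * FreeSemigroup.lift σ w = FreeSemigroup.lift σ w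

/-- The variety `V` satisfies the identity `w = 0`. -/
def VSatZero (V : SgVariety) (w : Word) : Prop :=
  ∀ (S : Type) [Semigroup S], Models S V.th → SatZeroS S w

/-- The words `x²`, `x³`, `x²y`, `xy²`, `x²yz`. -/
def w_xx : Word := xw * xw
def w_xxx : Word := xw * xw * xw
def w_xxy : Word := xw * xw * yw
def w_xyy : Word := xw * yw * yw
def w_xxyz : Word := xw * xw * yw * zw

/-- The identity `x²y = xy²`. -/
def idQ : SgId := (w_xxy, w_xyy)

/-- The pair of identities expressing `w = 0`, with `k` a fresh letter. -/
def zeroPair (w : Word) (k : ℕ) : Set SgId :=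
  {(w * FreeSemigroup.of k, w), (FreeSemigroup.of k * w, w)}

/-- `xprodTo n = x₁x₂⋯xₙ` (for `n ≥ 1`), on the letters `0, …, n-1`. -/
def xprodTo : ℕ → Word
  | 0 => FreeSemigroup.of 0
  | 1 => FreeSemigroup.of 0
  | n + 2 => xprodTo (n + 1) * FreeSemigroup.of (n + 1)

/-- `I = var{x²y = xy², x²yz = 0, xy = yx}`. -/
def Ivar : SgVariety := varOf ({commId, idQ} ∪ zeroPair w_xxyz 3)

/-- `K = var{x²y = 0, xy = yx}`. -/
def Kvar : SgVariety := varOf ({commId} ∪ zeroPair w_xxy 2)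

/-- `L = var{x² = 0, xy = yx}`. -/
def Lvar : SgVariety := varOf ({commId} ∪ zeroPair w_xx 1)

/-- `I_n = var{x²yz = x₁⋯xₙ = 0, x²y = xy², xy = yx}`. -/
def Ivarn (n : ℕ) : SgVariety :=
  varOf ({commId, idQ} ∪ zeroPair w_xxyz 3 ∪ zeroPair (xprodTo n) n)

/-- `J = var{x²yz = x³ = 0, x²y = xy², xy = yx}`. -/
def Jvar : SgVariety := varOf ({commId, idQ} ∪ zeroPair w_xxyz 3 ∪ zeroPair w_xxx 1)

/-- `J_n = var{x²yz = x³ = x₁⋯xₙ = 0, x²y = xy², xy = yx}`. -/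
def Jvarn (n : ℕ) : SgVariety :=
  varOf ({commId, idQ} ∪ zeroPair w_xxyz 3 ∪ zeroPair w_xxx 1 ∪ zeroPair (xprodTo n) n)

/-- `K_n = var{x²y = x₁⋯xₙ = 0, xy = yx}`. -/
def Kvarn (n : ℕ) : SgVariety :=
  varOf ({commId} ∪ zeroPair w_xxy 2 ∪ zeroPair (xprodTo n) n)

/-- `L_n = var{x² = x₁⋯xₙ = 0, xy = yx}`. -/
def Lvarn (n : ℕ) : SgVariety :=
  varOf ({commId} ∪ zeroPair w_xx 1 ∪ zeroPair (xprodTo n) n)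

/-- Generators of `ZR(U)`: the commutative law together with all 0-reduced
identities (in the form of the corresponding identity pairs) holding in `U`. -/
def ZRgen (U : SgVariety) : Set SgId :=
  {commId} ∪ { e : SgId | ∃ (w : Word) (k : ℕ), ¬ occursIn k w ∧ VSatZero U w ∧
      (e = (w * FreeSemigroup.of k, w) ∨ e = (FreeSemigroup.of k * w, w)) }

/-- `ZR(U)`: the variety given by the commutative law and all 0-reduced
identities holding in `U`. -/
def ZRvar (U : SgVariety) : SgVariety := varOf (ZRgen U)

def Icom : ComVariety := ⟨Ivar, subset_eqTh _ (Set.mem_union_left _ (Set.mem_insert _ _))⟩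

def ZRcom (U : SgVariety) : ComVariety :=
  ⟨ZRvar U, subset_eqTh _ (Set.mem_union_left _ rfl)⟩

/-- All nilsemigroups in `V` are nilpotent of degree ≤ n, i.e. satisfy `x₁⋯xₙ = 0`. -/
def HasDegLe (V : SgVariety) (n : ℕ) : Prop :=
  ∀ (S : Type) [Semigroup S], Nonempty S → Models S V.th → IsNilS S → SatZeroS S (xprodTo n)

/-- `deg V = d` (with `d = ⊤` meaning infinite degree). -/
def DegIs (V : SgVariety) (d : ℕ∞) : Prop :=
  (∃ n : ℕ, 0 < n ∧ d = (n : ℕ∞) ∧ IsLeast {m : ℕ | 0 < m ∧ HasDegLe V m} n) ∨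
    (d = ⊤ ∧ ∀ n : ℕ, 0 < n → ¬ HasDegLe V n)

/-- Upper-modular element of a lattice. -/
def IsUpperModular {L : Type*} [Lattice L] (a : L) : Prop :=
  ∀ b c : L, b ≤ a → a ⊓ (b ⊔ c) = b ⊔ (a ⊓ c)

/-- Codistributive element of a lattice. -/
def IsCodistributive {L : Type*} [Lattice L] (a : L) : Prop :=
  ∀ b c : L, a ⊓ (b ⊔ c) = (a ⊓ b) ⊔ (a ⊓ c)

/-- Costandard element of a lattice. -/
def IsCostandard {L : Type*} [Lattice L] (a : L) : Prop :=
  ∀ b c : L, (a ⊓ b) ⊔ c = (a ⊔ c) ⊓ (b ⊔ c)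

/-- Modular element of a lattice. -/
def IsModularElt {L : Type*} [Lattice L] (a : L) : Prop :=
  ∀ b c : L, b ≤ c → (a ⊔ b) ⊓ c = (a ⊓ c) ⊔ b

/-- Neutral element of a lattice, via the median characterization
(equivalent to: every triple containing `a` generates a distributive
sublattice; Grätzer, "Lattice Theory: Foundation", Theorem 254). -/
def IsNeutralElt {L : Type*} [Lattice L] (a : L) : Prop :=
  ∀ b c : L, (a ⊓ b) ⊔ (b ⊓ c) ⊔ (c ⊓ a) = (a ⊔ b) ⊓ (b ⊔ c) ⊓ (c ⊔ a)

/-! ### Commutative words and fully invariant congruences -/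

namespace ComVariety

/-- The commutative image of a word: the multiset of its letters. -/
def content (w : Word) : Multiset ℕ := w.head ::ₘ (w.tail : Multiset ℕ)

@[simp] theorem content_of (i : ℕ) : content (FreeSemigroup.of i) = {i} := rfl

@[simp] theorem content_mul (u v : Word) : content (u * v) = content u + content v := by
  simp only [content, FreeSemigroup.head_mul, FreeSemigroup.tail_mul, ← Multiset.coe_add,
    ← Multiset.cons_coe, Multiset.cons_add]

theorem content_ne_zero (w : Word) : content w ≠ 0 := Multiset.cons_ne_zero

theorem exists_content_eq {s : Multiset ℕ} (hs : s ≠ 0) : ∃ w, content w = s := by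
  obtain ⟨a, ha⟩ := Multiset.exists_mem_of_ne_zero hs
  obtain ⟨t, rfl⟩ := Multiset.exists_cons_of_mem ha
  exact ⟨⟨a, t.toList⟩, by simp [content]⟩

theorem content_lift (τ : ℕ → Word) (w : Word) :
    content (FreeSemigroup.lift τ w) = (content w).bind fun i => content (τ i) := by
  induction w using FreeSemigroup.recOnMul with
  | ih1 i => simp
  | ih2 i v h1 h2 => simp only [map_mul, content_mul, h1, h2, Multiset.add_bind]

theorem lift_lift {S : Type*} [Semigroup S] (σ : ℕ → S) (τ : ℕ → Word) (w : Word) :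
    FreeSemigroup.lift σ (FreeSemigroup.lift τ w) =
      FreeSemigroup.lift (fun i => FreeSemigroup.lift σ (τ i)) w := by
  induction w using FreeSemigroup.recOnMul with
  | ih1 i => simp
  | ih2 i v h1 h2 => simp only [map_mul, h1, h2]

theorem coe_lift_eq_prod {S : Type*} [CommSemigroup S] (σ : ℕ → S) (w : Word) :
    ((FreeSemigroup.lift σ w : S) : WithOne S) =
      ((content w).map fun i => (σ i : WithOne S)).prod := by
  induction w using FreeSemigroup.recOnMul with
  | ih1 i => simp
  | ih2 i v h1 h2 => simp only [map_mul, WithOne.coe_mul, content_mul, h1, h2, Multiset.map_add,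
      Multiset.prod_add]

theorem mem_eqTh_commId_of_content_eq {u v : Word} (h : content u = content v) :
    (u, v) ∈ eqTh {commId} := by
  intro S _ hS σ
  let _ : CommSemigroup S :=
    { (inferInstance : Semigroup S) with
      mul_comm := fun a b => by
        simpa [commId, xw, yw] using hS commId rfl fun i => if i = 0 then a else b }
  apply WithOne.coe_injective
  rw [coe_lift_eq_prod, coe_lift_eq_prod, h]

/-- A fully invariant congruence on the free commutative semigroup, presented as a relation on
multisets of letters for which the empty multiset is related only to itself. -/
structure IsFIC (r : Multiset ℕ → Multiset ℕ → Prop) : Prop where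
  refl : ∀ s, r s s
  symm : ∀ {s t}, r s t → r t s
  trans : ∀ {s t u}, r s t → r t u → r s u
  add : ∀ {s t} (c), r s t → r (s + c) (t + c)
  subst : ∀ {s t} (σ : ℕ → Multiset ℕ), (∀ i, σ i ≠ 0) → r s t → r (s.bind σ) (t.bind σ)
  ne_zero : ∀ {s t}, r s t → s ≠ 0 → t ≠ 0

/-- The fully invariant congruence of a commutative variety. -/
def rel (V : ComVariety) (s t : Multiset ℕ) : Prop :=
  s = t ∨ ∃ u v, content u = s ∧ content v = t ∧ (u, v) ∈ V.1.th

theorem mem_th_of_models {V : SgVariety} {e : SgId}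
    (h : ∀ (S : Type) [Semigroup S], Models S V.th → SatS S e) : e ∈ V.th := by
  rw [← V.closed]
  exact h

theorem mem_th_of_content_eq (V : ComVariety) {u v : Word} (h : content u = content v) :
    (u, v) ∈ V.1.th := by
  rw [← V.1.closed]
  exact eqTh_mono (Set.singleton_subset_iff.2 V.2) (mem_eqTh_commId_of_content_eq h)

theorem th_trans {V : SgVariety} {u v w : Word} (h : (u, v) ∈ V.th) (h' : (v, w) ∈ V.th) :
    (u, w) ∈ V.th :=
  mem_th_of_models fun _ _ hS σ => (hS _ h σ).trans (hS _ h' σ)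

theorem rel_content {V : ComVariety} {u v : Word} :
    rel V (content u) (content v) ↔ (u, v) ∈ V.1.th := by
  constructor
  · rintro (h | ⟨u', v', hu, hv, h⟩)
    · exact mem_th_of_content_eq V h
    · exact th_trans (mem_th_of_content_eq V hu.symm) (th_trans h (mem_th_of_content_eq V hv))
  · exact fun h => Or.inr ⟨u, v, rfl, rfl, h⟩

theorem rel_isFIC (V : ComVariety) : IsFIC (rel V) where
  refl s := Or.inl rfl
  symm := by
    rintro s t (rfl | ⟨u, v, rfl, rfl, h⟩)
    · exact Or.inl rfl
    · exact rel_content.2 (mem_th_of_models fun _ _ hS σ => (hS _ h σ).symm)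
  trans := by
    rintro s t w (rfl | ⟨u, v, rfl, rfl, h⟩) (rfl | ⟨u', v', h1, rfl, h'⟩)
    · exact Or.inl rfl
    · exact Or.inr ⟨u', v', h1, rfl, h'⟩
    · exact rel_content.2 h
    · exact rel_content.2 (th_trans h (th_trans (mem_th_of_content_eq V h1.symm) h'))
  add := by
    rintro s t c (rfl | ⟨u, v, rfl, rfl, h⟩)
    · exact Or.inl rfl
    · by_cases hc : c = 0
      · simpa [hc] using rel_content.2 h
      · obtain ⟨w, rfl⟩ := exists_content_eq hc
        rw [← content_mul, ← content_mul]
        refine rel_content.2 (mem_th_of_models fun _ _ hS σ => ?_)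
        simp only [map_mul]
        exact congrArg (· * _) (hS _ h σ)
  subst := by
    rintro s t σ hσ (rfl | ⟨u, v, rfl, rfl, h⟩)
    · exact Or.inl rfl
    · choose τ hτ using fun i => exists_content_eq (hσ i)
      obtain rfl : σ = fun i => content (τ i) := funext fun i => (hτ i).symm
      rw [← content_lift, ← content_lift]
      refine rel_content.2 (mem_th_of_models fun _ _ hS ρ => ?_)
      simp only [lift_lift]
      exact hS _ h _
  ne_zero := by
    rintro s t (rfl | ⟨u, v, rfl, rfl, h⟩) hs
    · exact hs
    · exact content_ne_zero v

/-- The congruence on words induced by a fully invariant congruence on commutative words. -/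
def wordCon {r : Multiset ℕ → Multiset ℕ → Prop} (h : IsFIC r) : Con Word where
  r u v := r (content u) (content v)
  iseqv := ⟨fun _ => h.refl _, h.symm, h.trans⟩
  mul' := by
    intro a b c d hab hcd
    simp only [content_mul]
    refine h.trans (h.add _ hab) ?_
    rw [add_comm, add_comm (content b)]
    exact h.add _ hcd

theorem lift_mk_wordCon {r : Multiset ℕ → Multiset ℕ → Prop} (h : IsFIC r) (τ : ℕ → Word)
    (w : Word) :
    FreeSemigroup.lift (fun i => (τ i : (wordCon h).Quotient)) w =
      ((FreeSemigroup.lift τ w : Word) : (wordCon h).Quotient) := by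
  induction w using FreeSemigroup.recOnMul with
  | ih1 i => simp
  | ih2 i v h1 h2 => simp only [map_mul, h1, h2, Con.coe_mul]

/-- The commutative variety whose congruence is a given fully invariant one. -/
def ofRel (r : Multiset ℕ → Multiset ℕ → Prop) (h : IsFIC r) : ComVariety :=
  ⟨⟨{e | r (content e.1) (content e.2)}, by
    refine Set.Subset.antisymm ?_ (subset_eqTh _)
    rintro ⟨u, v⟩ huv
    have key := huv (wordCon h).Quotient (by
      rintro ⟨a, b⟩ hab σ
      choose τ hτ using fun i => Quotient.exists_rep (σ i)
      obtain rfl : σ = fun i => (τ i : (wordCon h).Quotient) := funext fun i => (hτ i).symm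
      rw [lift_mk_wordCon, lift_mk_wordCon, Con.eq]
      change r _ _
      rw [content_lift, content_lift]
      exact h.subst _ (fun i => content_ne_zero _) hab)
      (fun i => ((FreeSemigroup.of i : Word) : (wordCon h).Quotient))
    rw [lift_mk_wordCon, lift_mk_wordCon, Con.eq] at key
    have hid : ∀ w : Word, content (FreeSemigroup.lift FreeSemigroup.of w) = content w := by
      intro w
      rw [content_lift]
      exact (Multiset.bind_singleton _ id).trans (Multiset.map_id _)
    change r _ _ at key
    rwa [hid, hid] at key⟩, by
    change r _ _
    simp only [commId, content_mul]
    rw [add_comm]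
    exact h.refl _⟩

theorem rel_ofRel {r : Multiset ℕ → Multiset ℕ → Prop} (h : IsFIC r) {s t : Multiset ℕ} :
    rel (ofRel r h) s t ↔ r s t := by
  constructor
  · rintro (rfl | ⟨u, v, rfl, rfl, huv⟩)
    · exact h.refl _
    · exact huv
  · intro hr
    by_cases hs : s = 0
    · by_cases ht : t = 0
      · exact Or.inl (hs.trans ht.symm)
      · exact absurd hs (h.ne_zero (h.symm hr) ht)
    · obtain ⟨u, rfl⟩ := exists_content_eq hs
      obtain ⟨v, rfl⟩ := exists_content_eq (h.ne_zero hr hs)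
      exact rel_content.2 hr

theorem le_iff_rel {V W : ComVariety} : V ≤ W ↔ ∀ s t, rel W s t → rel V s t := by
  constructor
  · rintro h s t (rfl | ⟨u, v, rfl, rfl, huv⟩)
    · exact Or.inl rfl
    · exact rel_content.2 (h huv)
  · rintro h ⟨u, v⟩ huv
    exact rel_content.1 (h _ _ (rel_content.2 huv))

theorem eq_of_rel_iff {V W : ComVariety} (h : ∀ s t, rel V s t ↔ rel W s t) : V = W :=
  le_antisymm (le_iff_rel.2 fun s t => (h s t).2) (le_iff_rel.2 fun s t => (h s t).1)

theorem rel_sup {V W : ComVariety} {s t : Multiset ℕ} :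
    rel (V ⊔ W) s t ↔ rel V s t ∧ rel W s t := by
  constructor
  · exact fun h => ⟨le_iff_rel.1 le_sup_left _ _ h, le_iff_rel.1 le_sup_right _ _ h⟩
  · rintro ⟨h | ⟨u, v, rfl, rfl, h⟩, h'⟩
    · exact Or.inl h
    · exact rel_content.2 ⟨h, rel_content.1 h'⟩

theorem IsFIC.join {r r' : Multiset ℕ → Multiset ℕ → Prop} (h : IsFIC r) (h' : IsFIC r') :
    IsFIC (Relation.ReflTransGen fun s t => r s t ∨ r' s t) where
  refl _ := Relation.ReflTransGen.refl
  symm := by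
    have : Std.Symm fun s t => r s t ∨ r' s t := ⟨fun _ _ hst => hst.imp h.symm h'.symm⟩
    exact fun {s t} hst => Std.Symm.symm s t hst
  trans := Relation.ReflTransGen.trans
  add c hst := hst.lift (· + c) fun _ _ hab => hab.imp (h.add c) (h'.add c)
  subst σ hσ hst := hst.lift (·.bind σ) fun _ _ hab => hab.imp (h.subst σ hσ) (h'.subst σ hσ)
  ne_zero hst hs := by
    induction hst with
    | refl => exact hs
    | tail _ hbc ih => exact hbc.elim (fun hb => h.ne_zero hb ih) (fun hb => h'.ne_zero hb ih)

theorem rel_inf {V W : ComVariety} {s t : Multiset ℕ} :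
    rel (V ⊓ W) s t ↔ Relation.ReflTransGen (fun s t => rel V s t ∨ rel W s t) s t := by
  constructor
  · intro h
    have hJ := (rel_isFIC V).join (rel_isFIC W)
    have hle : ofRel _ hJ ≤ V ⊓ W :=
      le_inf (le_iff_rel.2 fun s t hst => (rel_ofRel hJ).2 (.single (Or.inl hst)))
        (le_iff_rel.2 fun s t hst => (rel_ofRel hJ).2 (.single (Or.inr hst)))
    exact (rel_ofRel hJ).1 (le_iff_rel.1 hle _ _ h)
  · intro h
    induction h with
    | refl => exact Or.inl rfl
    | tail _ hbc ih =>
      exact (rel_isFIC _).trans ih (hbc.elim (le_iff_rel.1 inf_le_left _ _)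
        (le_iff_rel.1 inf_le_right _ _))

theorem rel_inf_left {V W : ComVariety} {s t : Multiset ℕ} (h : rel V s t) : rel (V ⊓ W) s t :=
  le_iff_rel.1 inf_le_left _ _ h

theorem rel_inf_right {V W : ComVariety} {s t : Multiset ℕ} (h : rel W s t) : rel (V ⊓ W) s t :=
  le_iff_rel.1 inf_le_right _ _ h

/-! ### Substitutions -/

theorem bind_insert (a : ℕ) (w s : Multiset ℕ) :
    (s.bind fun i => {i} + if i = a then w else 0) = s + s.count a • w := by
  induction s using Multiset.induction_on with
  | empty => simp
  | cons b s ih =>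
    rw [Multiset.cons_bind, ih, ← Multiset.singleton_add b s]
    by_cases h : b = a
    · subst h
      simp only [if_true, Multiset.count_add, Multiset.count_singleton_self]
      module
    · simp only [if_neg h, Multiset.count_add, Multiset.count_singleton, if_neg (Ne.symm h)]
      module

theorem bind_collapse (a : ℕ) (w w' s : Multiset ℕ) :
    (s.bind fun i => if i = a then w' else w) = s.count a • w' + s.countP (· ≠ a) • w := by
  induction s using Multiset.induction_on with
  | empty => simp
  | cons b s ih =>
    rw [Multiset.cons_bind, ih, Multiset.count_cons, Multiset.countP_cons]
    by_cases h : b = a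
    · simp only [h, if_true, ne_eq, not_true_eq_false, if_false]
      module
    · simp only [h, Ne.symm h, if_false, ne_eq, not_false_eq_true, if_true]
      module

namespace IsFIC

variable {r : Multiset ℕ → Multiset ℕ → Prop}

theorem of_eq (h : IsFIC r) {s t : Multiset ℕ} (e : s = t) : r s t := e ▸ h.refl s

theorem insert (h : IsFIC r) {s t : Multiset ℕ} (a : ℕ) (w : Multiset ℕ) (hst : r s t) :
    r (s + s.count a • w) (t + t.count a • w) := by
  rw [← bind_insert, ← bind_insert]
  exact h.subst _ (by simp) hst

theorem map (h : IsFIC r) {s t : Multiset ℕ} (f : ℕ → ℕ) (hst : r s t) : r (s.map f) (t.map f) := by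
  have := h.subst (fun i => {f i}) (by simp) hst
  rwa [Multiset.bind_singleton, Multiset.bind_singleton] at this

theorem subst_two (h : IsFIC r) {p q p' q' : ℕ} {x y : ℕ} (hxy : x ≠ y) {s t : Multiset ℕ}
    (hs : s ≠ 0) (ht : t ≠ 0) (hr : r (p • {x} + q • {y}) (p' • {x} + q' • {y})) :
    r (p • s + q • t) (p' • s + q' • t) := by
  have := h.subst (fun i => if i = x then s else t) (by intro i; split_ifs <;> assumption) hr
  simpa [Multiset.add_bind, bind_collapse, Multiset.count_singleton, hxy, hxy.symm,
    ← Multiset.cons_zero, Multiset.countP_cons] using this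

theorem iterate (h : IsFIC r) {s w : Multiset ℕ} (hs : r s (s + w)) (j : ℕ) :
    r s (s + j • w) := by
  induction j with
  | zero => exact h.of_eq (by simp)
  | succ j ih => exact h.trans hs (h.trans (h.add w ih) (h.of_eq (by module)))

theorem absorbs_of_mem_right (h : IsFIC r) {s t : Multiset ℕ} {a : ℕ} (ha : a ∉ s)
    (hst : r s t) (w : Multiset ℕ) : r s (s + t.count a • w) := by
  have h1 := h.insert a w hst
  rw [Multiset.count_eq_zero.2 ha, zero_smul, add_zero] at h1
  exact h.trans h1 (h.add _ (h.symm hst))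

theorem absorbs_of_mem_left (h : IsFIC r) {s t : Multiset ℕ} {a : ℕ} (ha : a ∉ t)
    (hst : r s t) (w : Multiset ℕ) : r s (s + s.count a • w) := by
  have h1 := h.insert a w hst
  rw [Multiset.count_eq_zero.2 ha, zero_smul, add_zero] at h1
  exact h.trans hst (h.symm h1)

theorem exists_absorbs_of_toFinset_ne (h : IsFIC r) {s t : Multiset ℕ}
    (hne : s.toFinset ≠ t.toFinset) (hst : r s t) (x : ℕ) : ∃ p > 0, r s (s + p • {x}) := by
  by_cases h1 : s.toFinset ⊆ t.toFinset
  · obtain ⟨a, hat, has⟩ := Finset.not_subset.1 fun h2 => hne (h1.antisymm h2)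
    rw [Multiset.mem_toFinset] at hat has
    exact ⟨_, Multiset.count_pos.2 hat, h.absorbs_of_mem_right has hst _⟩
  · obtain ⟨a, has, hat⟩ := Finset.not_subset.1 h1
    rw [Multiset.mem_toFinset] at hat has
    exact ⟨_, Multiset.count_pos.2 has, h.absorbs_of_mem_left hat hst _⟩

theorem exists_absorbs_of_nodup (h : IsFIC r) {s t : Multiset ℕ} (hs : s.Nodup) (hne : s ≠ t)
    (hst : r s t) {x : ℕ} (hx : x ∈ s) : ∃ p > 0, r s (s + p • {x}) := by
  by_cases hsup : s.toFinset = t.toFinset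
  swap
  · exact h.exists_absorbs_of_toFinset_ne hsup hst x
  have hle : s ≤ t := (Multiset.le_iff_subset hs).2 fun a ha =>
    Multiset.mem_toFinset.1 (hsup ▸ Multiset.mem_toFinset.2 ha)
  obtain ⟨d, rfl⟩ := Multiset.le_iff_exists_add.1 hle
  have hd : d ≠ 0 := by rintro rfl; simp at hne
  obtain ⟨a, had⟩ := Multiset.exists_mem_of_ne_zero hd
  have has : a ∈ s := by
    have : a ∈ (s + d).toFinset := by simp [had]
    rw [← hsup] at this
    exact Multiset.mem_toFinset.1 this
  have hswap : s.map (Equiv.swap a x) = s := by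
    refine Multiset.Nodup.ext (hs.map (Equiv.swap a x).injective) hs |>.2 fun b => ?_
    simp only [Multiset.mem_map]
    constructor
    · rintro ⟨c, hc, rfl⟩
      rw [Equiv.swap_apply_def]
      split_ifs <;> assumption
    · intro hb
      refine ⟨Equiv.swap a x b, ?_, Equiv.swap_apply_self a x b⟩
      rw [Equiv.swap_apply_def]
      split_ifs <;> assumption
  have h1 := h.map (Equiv.swap a x) hst
  rw [Multiset.map_add, hswap] at h1
  have hxd : x ∈ d.map (Equiv.swap a x) :=
    Multiset.mem_map.2 ⟨a, had, Equiv.swap_apply_left a x⟩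
  generalize d.map (Equiv.swap a x) = d' at h1 hxd
  obtain ⟨e, rfl⟩ := Multiset.exists_cons_of_mem hxd
  rw [← Multiset.singleton_add] at h1
  have h2 := h.insert x {x} h1
  rw [Multiset.count_add, Multiset.count_add, Multiset.count_singleton_self,
    Multiset.count_eq_one_of_mem hs hx] at h2
  refine ⟨1 + e.count x, by omega, h.trans h1 ?_⟩
  refine h.trans (h.trans (h.of_eq ?_) (h.add e h2)) ?_
  · module
  refine h.trans (h.of_eq ?_) (h.trans (h.add (e + (1 + (1 + e.count x)) • {x}) (h.symm h1)) ?_)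
  · module
  have h3 := h.add ((1 + e.count x) • {x}) (h.symm h1)
  refine h.trans (h.of_eq ?_) h3
  module

end IsFIC

/-- The nonlinear commutative words of length at least four. -/
def IsLong (s : Multiset ℕ) : Prop := 4 ≤ s.card ∧ ¬ s.Nodup

/-- The words `a²b` and `ab²`. -/
def IsSwap (s t : Multiset ℕ) : Prop := ∃ a b : ℕ, s = 2 • {a} + {b} ∧ t = {a} + 2 • {b}

theorem IsSwap.symm {s t : Multiset ℕ} (h : IsSwap s t) : IsSwap t s := by
  obtain ⟨a, b, rfl, rfl⟩ := h
  exact ⟨b, a, by module, by module⟩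

theorem IsSwap.unique {s t u : Multiset ℕ} (h : IsSwap s t) (h' : IsSwap s u) : t = u := by
  obtain ⟨a, b, rfl, rfl⟩ := h
  obtain ⟨c, d, h', rfl⟩ := h'
  have ha := congrArg (Multiset.count a) h'
  have hb := congrArg (Multiset.count b) h'
  simp only [Multiset.count_add, Multiset.count_nsmul, Multiset.count_singleton] at ha hb
  have : a = c ∧ b = d := by grind
  rw [this.1, this.2]

theorem IsLong.add {s : Multiset ℕ} (h : IsLong s) (c : Multiset ℕ) : IsLong (s + c) :=
  ⟨h.1.trans (by simp), fun hn => h.2 (Multiset.nodup_of_le (Multiset.le_add_right s c) hn)⟩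

theorem isLong_add_smul_singleton {s : Multiset ℕ} {x n : ℕ} (hx : x ∈ s) (hn : 3 ≤ n) :
    IsLong (s + n • {x}) := by
  have h1 : 0 < s.count x := Multiset.count_pos.2 hx
  have h2 : s.count x ≤ s.card := Multiset.count_le_card x s
  refine ⟨by simp; omega, fun hd => ?_⟩
  have := Multiset.nodup_iff_count_le_one.1 hd x
  simp at this
  omega

theorem card_le_card_bind {s : Multiset ℕ} {σ : ℕ → Multiset ℕ} (hσ : ∀ i, σ i ≠ 0) :
    s.card ≤ (s.bind σ).card := by
  induction s using Multiset.induction_on with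
  | empty => simp
  | cons a s ih =>
    have := Multiset.card_pos.2 (hσ a)
    simp only [Multiset.card_cons, Multiset.cons_bind, Multiset.card_add]
    omega

theorem exists_eq_two_smul_add {s : Multiset ℕ} (h : ¬ s.Nodup) : ∃ a t, s = 2 • {a} + t := by
  rw [Multiset.nodup_iff_le] at h
  push Not at h
  obtain ⟨a, ha⟩ := h
  obtain ⟨t, rfl⟩ := Multiset.le_iff_exists_add.1 ha
  exact ⟨a, t, by rw [two_smul]; rfl⟩

theorem IsLong.bind {s : Multiset ℕ} (h : IsLong s) {σ : ℕ → Multiset ℕ} (hσ : ∀ i, σ i ≠ 0) :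
    IsLong (s.bind σ) := by
  refine ⟨h.1.trans (card_le_card_bind hσ), ?_⟩
  obtain ⟨a, t, rfl⟩ := exists_eq_two_smul_add h.2
  obtain ⟨x, hx⟩ := Multiset.exists_mem_of_ne_zero (hσ a)
  intro hd
  have h1 := Multiset.nodup_iff_count_le_one.1 hd x
  have h2 := Multiset.count_pos.2 hx
  simp only [two_smul, Multiset.add_bind, Multiset.singleton_bind, Multiset.count_add] at h1
  omega

theorem nodup_or_of_not_isLong {s : Multiset ℕ} (h : ¬ IsLong s) :
    s.Nodup ∨ (∃ a, s = 2 • {a}) ∨ ∃ a b, s = 2 • {a} + {b} := by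
  by_cases hd : s.Nodup
  · exact Or.inl hd
  obtain ⟨a, t, rfl⟩ := exists_eq_two_smul_add hd
  have hc : t.card < 2 := by
    by_contra hc
    exact h ⟨by simp; omega, hd⟩
  interval_cases ht : t.card
  · exact Or.inr (Or.inl ⟨a, by rw [Multiset.card_eq_zero.1 ht, add_zero]⟩)
  · obtain ⟨b, rfl⟩ := Multiset.card_eq_one.1 ht
    exact Or.inr (Or.inr ⟨a, b, rfl⟩)

namespace IsFIC

variable {r : Multiset ℕ → Multiset ℕ → Prop}

theorem exists_absorbs_of_power (h : IsFIC r) {k x : ℕ} {t : Multiset ℕ} (hk : 0 < k)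
    (hne : k • {x} ≠ t) (hst : r (k • {x}) t) : ∃ p > 0, r (k • {x}) (k • {x} + p • {x}) := by
  by_cases hsup : (k • {x} : Multiset ℕ).toFinset = t.toFinset
  swap
  · exact h.exists_absorbs_of_toFinset_ne hsup hst x
  have ht : t = t.card • {x} := by
    rw [Multiset.nsmul_singleton]
    refine Multiset.eq_replicate_card.2 fun b hb => ?_
    rw [← Multiset.mem_toFinset, ← hsup, Multiset.toFinset_nsmul _ _ hk.ne'] at hb
    simpa using hb
  rw [ht] at hst hne
  generalize t.card = m at hst hne
  have hkm : k ≠ m := fun e => hne (by rw [e])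
  rcases lt_or_gt_of_ne hkm with hlt | hlt
  · obtain ⟨p, rfl⟩ := Nat.exists_eq_add_of_lt hlt
    exact ⟨p + 1, by omega, h.trans hst (h.of_eq (by module))⟩
  · obtain ⟨p, rfl⟩ := Nat.exists_eq_add_of_lt hlt
    refine ⟨p + 1, by omega, ?_⟩
    refine h.trans (h.of_eq ?_) (h.add ((p + 1) • {x}) (h.trans (h.symm hst) (h.of_eq ?_))) <;>
      module

theorem absorbs_left_of_absorbs_both (h : IsFIC r) {x y p q : ℕ} (hxy : x ≠ y)
    (hr : r (2 • {x} + {y}) (2 • {x} + {y} + p • {x} + q • {y})) :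
    r (2 • {x} + {y}) (2 • {x} + {y} + (p * q) • {x}) := by
  have h1 := h.insert y (p • {x}) hr
  simp only [Multiset.count_add, Multiset.count_nsmul, Multiset.count_singleton_self,
    Multiset.count_singleton, hxy.symm, if_false] at h1
  have h2 : r (2 • {x} + {y} + p • {x}) (2 • {x} + {y} + p • {x} + (p * q) • {x}) := by
    refine h.trans (h.trans (h.of_eq ?_) (h.trans h1 (h.of_eq ?_)))
      (h.trans (h.add (p • {x} + (p * q) • {x}) (h.symm hr)) (h.of_eq ?_)) <;> module
  refine h.trans hr (h.trans (h.add (q • {y}) h2) ?_)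
  refine h.trans (h.of_eq ?_) (h.trans (h.add ((p * q) • {x}) (h.symm hr)) (h.of_eq ?_)) <;> module

theorem exists_absorbs_of_square_mul (h : IsFIC r) {x y : ℕ} {t : Multiset ℕ} (hxy : x ≠ y)
    (hne : 2 • {x} + {y} ≠ t) (hne' : {x} + 2 • {y} ≠ t) (hst : r (2 • {x} + {y}) t) :
    ∃ p > 0, r (2 • {x} + {y}) (2 • {x} + {y} + p • {x}) := by
  by_cases hsup : (2 • {x} + {y} : Multiset ℕ).toFinset = t.toFinset
  swap
  · exact h.exists_absorbs_of_toFinset_ne hsup hst x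
  have hmem : ∀ b, b ∈ t ↔ b = x ∨ b = y := by
    intro b
    rw [← Multiset.mem_toFinset, ← hsup]
    simp [two_smul]
  have ht : t = t.count x • {x} + t.count y • {y} := by
    ext b
    by_cases hbx : b = x
    · subst hbx
      simp [hxy]
    · by_cases hby : b = y
      · subst hby
        simp [hxy.symm]
      · simp [hbx, hby, Multiset.count_eq_zero, hmem]
  have hk : 0 < t.count x := Multiset.count_pos.2 ((hmem x).2 (Or.inl rfl))
  have hm : 0 < t.count y := Multiset.count_pos.2 ((hmem y).2 (Or.inr rfl))
  rw [ht] at hst hne hne'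
  generalize t.count x = k at hst hne hne' hk
  generalize t.count y = m at hst hne hne' hm
  have both : ∀ q > 0, r (2 • {x} + {y}) (2 • {x} + {y} + q • {x} + q • {y}) →
      ∃ p > 0, r (2 • {x} + {y}) (2 • {x} + {y} + p • {x}) := fun q hq hr =>
    ⟨q * q, by positivity, h.absorbs_left_of_absorbs_both hxy hr⟩
  have sub : ∀ {s s' : Multiset ℕ}, s ≠ 0 → s' ≠ 0 → r (2 • s + s') (k • s + m • s') := by
    intro s s' hs hs'
    have := h.subst_two (p := 2) (q := 1) (p' := k) (q' := m) hxy hs hs'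
      (by rwa [one_smul])
    rwa [one_smul] at this
  have swapped := sub (Multiset.singleton_ne_zero y) (Multiset.singleton_ne_zero x)
  obtain rfl | ⟨k, rfl⟩ : k = 1 ∨ ∃ p, k = p + 2 := by
    rcases k with _ | _ | k
    · omega
    · exact Or.inl rfl
    · exact Or.inr ⟨k, rfl⟩
  · obtain rfl | rfl | ⟨m, rfl⟩ : m = 1 ∨ m = 2 ∨ ∃ p, m = p + 3 := by
      rcases m with _ | _ | _ | m
      · omega
      · exact Or.inl rfl
      · exact Or.inr (Or.inl rfl)
      · exact Or.inr (Or.inr ⟨m, rfl⟩)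
    · refine ⟨1, one_pos, ?_⟩
      refine h.trans (h.of_eq ?_) (h.trans (h.add {x} (h.symm hst)) (h.of_eq ?_)) <;> module
    · exact absurd (by module) hne'
    · refine both (m + 1) (by omega) (h.trans hst ?_)
      refine h.trans (h.of_eq ?_) (h.trans (h.add ((m + 1) • {y}) swapped) (h.of_eq ?_)) <;> module
  · obtain ⟨m, rfl⟩ : ∃ q, m = q + 1 := ⟨m - 1, by omega⟩
    rcases Nat.eq_zero_or_pos m with rfl | hm0
    · refine ⟨k, Nat.pos_of_ne_zero fun e => hne ?_, h.trans hst (h.of_eq ?_)⟩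
      · rw [e]; module
      · module
    · rcases Nat.eq_zero_or_pos k with rfl | hk0
      · refine both m hm0 (h.trans hst ?_)
        obtain ⟨m, rfl⟩ : ∃ q, m = q + 1 := ⟨m - 1, by omega⟩
        refine h.trans (h.of_eq ?_) (h.trans (h.add ({x} + m • {y}) swapped) (h.of_eq ?_)) <;>
          module
      · refine ⟨k * m, by positivity, h.absorbs_left_of_absorbs_both hxy
          (h.trans hst (h.of_eq ?_))⟩
        module

/-- A short nonzero word `s` has a letter `x` such that every fully invariant congruence which
identifies `s` with another word, its swap excepted, makes `s` absorb a power of `x`. -/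
theorem exists_letter_absorbed {s : Multiset ℕ} (hs : s ≠ 0) (hl : ¬ IsLong s) :
    ∃ x ∈ s, ∀ {r : Multiset ℕ → Multiset ℕ → Prop}, IsFIC r → ∀ {t}, s ≠ t → ¬ IsSwap s t →
      r s t → ∃ p > 0, r s (s + p • {x}) := by
  rcases nodup_or_of_not_isLong hl with hd | ⟨a, rfl⟩ | ⟨a, b, rfl⟩
  · obtain ⟨x, hx⟩ := Multiset.exists_mem_of_ne_zero hs
    exact ⟨x, hx, fun h _ hne _ hst => h.exists_absorbs_of_nodup hd hne hst hx⟩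
  · exact ⟨a, by simp, fun h _ hne _ hst => h.exists_absorbs_of_power two_pos hne hst⟩
  · refine ⟨a, by simp, fun h t hne hsw hst => ?_⟩
    by_cases hab : a = b
    · subst hab
      have e : (2 • {a} + {a} : Multiset ℕ) = 3 • {a} := by module
      rw [e] at hne hst ⊢
      exact h.exists_absorbs_of_power three_pos hne hst
    · exact h.exists_absorbs_of_square_mul hab hne (fun e => hsw ⟨a, b, rfl, e.symm⟩) hst

end IsFIC

/-! ### Sufficiency -/

theorem IsLong.ne_zero {s : Multiset ℕ} (h : IsLong s) : s ≠ 0 := by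
  rintro rfl
  exact h.2 Multiset.nodup_zero

theorem IsLong.map {s : Multiset ℕ} (h : IsLong s) (f : ℕ → ℕ) : IsLong (s.map f) := by
  have := h.bind (σ := fun i => {f i}) (by simp)
  rwa [Multiset.bind_singleton] at this

theorem IsSwap.exists_map_eq {s t : Multiset ℕ} (h : IsSwap s t) : ∃ f : ℕ → ℕ, s.map f = t := by
  obtain ⟨a, b, rfl, rfl⟩ := h
  refine ⟨Equiv.swap a b, ?_⟩
  simp only [Multiset.map_add, Multiset.map_nsmul, Multiset.map_singleton,
    Equiv.swap_apply_left, Equiv.swap_apply_right]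
  module

theorem IsSwap.toFinset_eq {s t : Multiset ℕ} (h : IsSwap s t) : s.toFinset = t.toFinset := by
  obtain ⟨a, b, rfl, rfl⟩ := h
  simp [two_smul]

theorem toFinset_add_smul_singleton {s : Multiset ℕ} {x : ℕ} (hx : x ∈ s) (n : ℕ) :
    (s + n • {x}).toFinset = s.toFinset := by
  ext b
  simp only [Multiset.toFinset_add, Finset.mem_union, Multiset.mem_toFinset]
  refine ⟨fun h => h.elim id fun h => ?_, Or.inl⟩
  rwa [Multiset.mem_singleton.1 (Multiset.mem_of_mem_nsmul h)]

theorem IsFIC.ne_zero_of_ne {r : Multiset ℕ → Multiset ℕ → Prop} (h : IsFIC r)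
    {s t : Multiset ℕ} (hst : r s t) (hne : s ≠ t) : s ≠ 0 := by
  rintro rfl
  exact h.ne_zero (h.symm hst) hne.symm rfl

theorem IsFIC.exists_isLong {r : Multiset ℕ → Multiset ℕ → Prop} (h : IsFIC r)
    {s t : Multiset ℕ} (hst : r s t) (hne : s ≠ t) (hsw : ¬ IsSwap s t) :
    ∃ j, IsLong j ∧ r s j := by
  by_cases hl : IsLong s
  · exact ⟨s, hl, h.refl s⟩
  obtain ⟨x, hx, H⟩ := IsFIC.exists_letter_absorbed (h.ne_zero_of_ne hst hne) hl
  obtain ⟨p, hp, hr⟩ := H h hne hsw hst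
  refine ⟨_, isLong_add_smul_singleton (n := 3 * p) hx (by omega), ?_⟩
  rw [mul_smul]
  exact h.iterate hr 3

/-- The congruence of a variety satisfying `x²yz = 0` and `x²y = xy²`. -/
structure IsSmallNil (α : Multiset ℕ → Multiset ℕ → Prop) : Prop extends IsFIC α where
  long : ∀ {s t}, IsLong s → IsLong t → α s t
  swap : ∀ {s t}, IsSwap s t → α s t

/-- The words that are zero modulo `α`. -/
def IsZeroWord (α : Multiset ℕ → Multiset ℕ → Prop) (s : Multiset ℕ) : Prop :=
  ∃ j, IsLong j ∧ α s j

/-- The words identified by `β` with a word that is zero modulo `α`. -/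
def ReachesZero (α β : Multiset ℕ → Multiset ℕ → Prop) (s : Multiset ℕ) : Prop :=
  ∃ a, IsZeroWord α a ∧ β s a

namespace IsSmallNil

variable {α β γ : Multiset ℕ → Multiset ℕ → Prop} {s t : Multiset ℕ}

theorem zero_of_rel (hα : IsSmallNil α) (hst : α s t) (hs : IsZeroWord α s) : IsZeroWord α t := by
  obtain ⟨j, hj, hsj⟩ := hs
  exact ⟨j, hj, hα.trans (hα.symm hst) hsj⟩

theorem zero_of_isLong (hα : IsSmallNil α) (hs : IsLong s) : IsZeroWord α s :=
  ⟨s, hs, hα.refl s⟩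

theorem rel_of_zero (hα : IsSmallNil α) (hs : IsZeroWord α s) (ht : IsZeroWord α t) : α s t := by
  obtain ⟨i, hi, hsi⟩ := hs
  obtain ⟨j, hj, htj⟩ := ht
  exact hα.trans hsi (hα.trans (hα.long hi hj) (hα.symm htj))

theorem zero_add (hα : IsSmallNil α) (hs : IsZeroWord α s) (c : Multiset ℕ) :
    IsZeroWord α (s + c) := by
  obtain ⟨j, hj, hsj⟩ := hs
  exact ⟨j + c, hj.add c, hα.add c hsj⟩

theorem eq_or_swap_or_zero (hα : IsSmallNil α) (hst : α s t) :
    s = t ∨ IsSwap s t ∨ IsZeroWord α s ∧ IsZeroWord α t := by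
  by_cases hne : s = t
  · exact Or.inl hne
  by_cases hsw : IsSwap s t
  · exact Or.inr (Or.inl hsw)
  have hs : IsZeroWord α s := hα.toIsFIC.exists_isLong hst hne hsw
  exact Or.inr (Or.inr ⟨hs, hα.zero_of_rel hst hs⟩)

theorem reachesZero_of_zero (hβ : IsFIC β) (hs : IsZeroWord α s) : ReachesZero α β s :=
  ⟨s, hs, hβ.refl s⟩

theorem reachesZero_of_rel (hβ : IsFIC β) (hst : β s t) (hs : ReachesZero α β s) :
    ReachesZero α β t := by
  obtain ⟨a, ha, hsa⟩ := hs
  exact ⟨a, ha, hβ.trans (hβ.symm hst) hsa⟩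

theorem reachesZero_map (hα : IsSmallNil α) (hβ : IsFIC β) {j : Multiset ℕ} (hj : IsLong j)
    (hsj : β s j) (f : ℕ → ℕ) : ReachesZero α β (s.map f) :=
  ⟨_, hα.zero_of_isLong (hj.map f), hβ.map f hsj⟩

theorem reachesZero_of_swap (hα : IsSmallNil α) (hβ : IsFIC β) (hst : IsSwap s t)
    (hs : ReachesZero α β s) : ReachesZero α β t := by
  obtain ⟨a, ha, hsa⟩ := hs
  by_cases hne : s = a
  · exact reachesZero_of_zero hβ (hα.zero_of_rel (hα.swap hst) (hne ▸ ha))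
  by_cases hsw : IsSwap s a
  · exact reachesZero_of_zero hβ (hst.unique hsw ▸ ha)
  obtain ⟨j, hj, hsj⟩ := hβ.exists_isLong hsa hne hsw
  obtain ⟨f, rfl⟩ := hst.exists_map_eq
  exact hα.reachesZero_map hβ hj hsj f

theorem swap_rel (hα : IsSmallNil α) (hβ : IsFIC β) {u : Multiset ℕ} (hst : IsSwap s t)
    (htu : β t u) :
    β s u ∨ IsSwap s u ∨ ReachesZero α β s ∧ ReachesZero α β u := by
  by_cases hne : t = u
  · exact Or.inr (Or.inl (hne ▸ hst))
  by_cases hsw : IsSwap t u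
  · exact Or.inl (hst.symm.unique hsw ▸ hβ.refl s)
  obtain ⟨j, hj, htj⟩ := hβ.exists_isLong htu hne hsw
  have ht : ReachesZero α β t := ⟨j, hα.zero_of_isLong hj, htj⟩
  exact Or.inr (Or.inr ⟨hα.reachesZero_of_swap hβ hst.symm ht, reachesZero_of_rel hβ htu ht⟩)

theorem rel_or_swap_or_reachesZero (hα : IsSmallNil α) (hβ : IsFIC β)
    (hst : Relation.ReflTransGen (fun s t => α s t ∨ β s t) s t) :
    β s t ∨ IsSwap s t ∨ ReachesZero α β s ∧ ReachesZero α β t := by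
  induction hst with
  | refl => exact Or.inl (hβ.refl s)
  | @tail w t _ hwt ih =>
    rcases hwt with hwt | hwt
    · rcases hα.eq_or_swap_or_zero hwt with rfl | hsw | ⟨hw, ht⟩
      · exact ih
      · rcases ih with ih | ih | ⟨h1, h2⟩
        · rcases hα.swap_rel hβ hsw.symm (hβ.symm ih) with h | h | h
          · exact Or.inl (hβ.symm h)
          · exact Or.inr (Or.inl h.symm)
          · exact Or.inr (Or.inr h.symm)
        · exact Or.inl (ih.symm.unique hsw ▸ hβ.refl s)
        · exact Or.inr (Or.inr ⟨h1, hα.reachesZero_of_swap hβ hsw h2⟩)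
      · refine Or.inr (Or.inr ⟨?_, reachesZero_of_zero hβ ht⟩)
        rcases ih with ih | ih | ⟨h1, _⟩
        · exact ⟨w, hw, ih⟩
        · exact hα.reachesZero_of_swap hβ ih.symm (reachesZero_of_zero hβ hw)
        · exact h1
    · rcases ih with ih | ih | ⟨h1, h2⟩
      · exact Or.inl (hβ.trans ih hwt)
      · exact hα.swap_rel hβ ih hwt
      · exact Or.inr (Or.inr ⟨h1, reachesZero_of_rel hβ hwt h2⟩)

/-- If `β` joins `s` to a zero word of `α` and `γ` joins it to any essentially different word,
then both join it to a common zero word on the same letters. -/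
theorem exists_common_zero (hα : IsSmallNil α) (hβ : IsFIC β) (hγ : IsFIC γ)
    (hs : ReachesZero α β s) (hst : γ s t) (hne : s ≠ t) (hsw : ¬ IsSwap s t) :
    ∃ s', IsZeroWord α s' ∧ β s s' ∧ γ s s' ∧ s'.toFinset = s.toFinset := by
  by_cases hz : IsZeroWord α s
  · exact ⟨s, hz, hβ.refl s, hγ.refl s, rfl⟩
  obtain ⟨a, ha, hsa⟩ := hs
  have hl : ¬ IsLong s := fun h => hz (hα.zero_of_isLong h)
  obtain ⟨x, hx, H⟩ := IsFIC.exists_letter_absorbed (hγ.ne_zero_of_ne hst hne) hl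
  obtain ⟨p, hp, hp'⟩ := H hγ hne hsw hst
  obtain ⟨q, hq, hq'⟩ := H hβ (fun e => hz (e ▸ ha))
    (fun h => hz (hα.zero_of_rel (hα.swap h.symm) ha)) hsa
  have hpq : 3 ≤ 3 * p * q := by
    have := Nat.mul_pos hp hq
    nlinarith
  refine ⟨s + (3 * p * q) • {x}, hα.zero_of_isLong (isLong_add_smul_singleton hx hpq), ?_, ?_,
    toFinset_add_smul_singleton hx _⟩
  · rw [mul_smul]
    exact hβ.iterate hq' _
  · rw [mul_right_comm, mul_smul]
    exact hγ.iterate hp' _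

theorem rel_or_swap_or_exists_zero (hα : IsSmallNil α) (hβ : IsFIC β) (hγ : IsFIC γ)
    (hst : Relation.ReflTransGen (fun s t => α s t ∨ β s t) s t) (h : γ s t) :
    β s t ∨ IsSwap s t ∨ ∃ s' t', IsZeroWord α s' ∧ IsZeroWord α t' ∧
      (β s s' ∧ γ s s' ∧ s'.toFinset = s.toFinset) ∧
      (β t t' ∧ γ t t' ∧ t'.toFinset = t.toFinset) := by
  rcases hα.rel_or_swap_or_reachesZero hβ hst with h1 | h1 | ⟨hs, ht⟩
  · exact Or.inl h1
  · exact Or.inr (Or.inl h1)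
  by_cases hne : s = t
  · exact Or.inl (hβ.of_eq hne)
  by_cases hsw : IsSwap s t
  · exact Or.inr (Or.inl hsw)
  obtain ⟨s', hs', h1⟩ := hα.exists_common_zero hβ hγ hs h hne hsw
  obtain ⟨t', ht', h2⟩ := hα.exists_common_zero hβ hγ ht (hγ.symm h) (Ne.symm hne)
    (fun e => hsw e.symm)
  exact Or.inr (Or.inr ⟨s', t', hs', ht', h1, h2⟩)

end IsSmallNil

/-- A variety without semilattices satisfies `xⁿ = xⁿyⁿ` for suitable `n`. -/
theorem IsFIC.exists_smul_rel {r : Multiset ℕ → Multiset ℕ → Prop} (h : IsFIC r)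
    {s t : Multiset ℕ} (hst : r s t) (hne : s.toFinset ≠ t.toFinset) :
    ∃ a > 0, ∃ b, ∀ m, b < m → ∀ w w' : Multiset ℕ, w ≠ 0 → w' ≠ 0 →
      r ((a * m) • w) ((a * m) • w + (a * m) • w') := by
  obtain ⟨s, t, hst, x, hxs, hxt⟩ : ∃ s t, r s t ∧ ∃ x, x ∈ s ∧ x ∉ t := by
    by_cases h1 : s.toFinset ⊆ t.toFinset
    · obtain ⟨a, ha⟩ := Finset.not_subset.1 fun h2 => hne (h1.antisymm h2)
      exact ⟨t, s, h.symm hst, a, by simpa using ha⟩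
    · obtain ⟨a, ha⟩ := Finset.not_subset.1 h1
      exact ⟨s, t, hst, a, by simpa using ha⟩
  have G : ∀ w w' w'' : Multiset ℕ, w ≠ 0 → w' ≠ 0 → w'' ≠ 0 →
      r (s.count x • w' + s.countP (· ≠ x) • w) (s.count x • w'' + s.countP (· ≠ x) • w) := by
    intro w w' w'' hw hw' hw''
    have H : ∀ v : Multiset ℕ, v ≠ 0 →
        r (s.count x • v + s.countP (· ≠ x) • w) (t.countP (· ≠ x) • w) := by
      intro v hv
      have := h.subst (fun i => if i = x then v else w)
        (by intro i; split_ifs <;> assumption) hst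
      rwa [bind_collapse, bind_collapse, Multiset.count_eq_zero.2 hxt, zero_smul,
        _root_.zero_add] at this
    exact h.trans (H w' hw') (h.symm (H w'' hw''))
  have ha : 0 < s.count x := Multiset.count_pos.2 hxs
  generalize s.count x = a at G ha
  generalize s.countP (· ≠ x) = b at G
  refine ⟨a, ha, b, fun m hm w w' hw hw' => ?_⟩
  obtain ⟨c, hc⟩ : ∃ c, a * m = c + a + b := by
    refine ⟨a * m - a - b, ?_⟩
    have : a * (b + 1) ≤ a * m := Nat.mul_le_mul_left a hm
    have : b ≤ a * b := Nat.le_mul_of_pos_left b ha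
    have : a * (b + 1) = a * b + a := by ring
    omega
  have hm0 : m ≠ 0 := by omega
  have ne : ∀ {k : ℕ} {v : Multiset ℕ}, k ≠ 0 → v ≠ 0 → k • v ≠ 0 := fun hk hv =>
    smul_ne_zero hk hv
  have h1 : r ((a * m) • w) ((2 * (a * m)) • w) := by
    refine h.trans (h.of_eq ?_) (h.trans (h.add (c • w)
      (G w w ((m + 1) • w) hw hw (ne (by omega) hw))) (h.of_eq ?_))
    · rw [hc]; module
    · have : 2 * (a * m) = a * (m + 1) + b + c := by rw [mul_add, mul_one, two_mul]; omega
      rw [this]; module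
  refine h.trans h1 (h.trans (h.of_eq ?_) (h.trans (h.add ((c + a) • w)
    (G w (m • w) (m • w') hw (ne hm0 hw) (ne hm0 hw'))) (h.of_eq ?_)))
  · have : 2 * (a * m) = a * m + (c + a + b) := by omega
    rw [this]; module
  · have : (a * m) • w = (c + a + b) • w := by rw [hc]
    rw [this]; module

theorem IsSmallNil.rel_of_toFinset_ne {α β γ δ : Multiset ℕ → Multiset ℕ → Prop}
    (hα : IsSmallNil α) (hβ : IsFIC β) (hγ : IsFIC γ) (hδ : IsFIC δ)
    (hαδ : ∀ {s t}, α s t → γ s t → s.toFinset = t.toFinset → δ s t)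
    (hβδ : ∀ {s t}, β s t → γ s t → δ s t) (hδγ : ∀ {s t}, δ s t → γ s t)
    {a b : Multiset ℕ} (hab : β a b) (hne : a.toFinset ≠ b.toFinset)
    {s t : Multiset ℕ} (hs : IsZeroWord α s) (ht : IsZeroWord α t) (hst : γ s t)
    {x : ℕ} (hxs : x ∉ s) (hxt : x ∈ t) : δ s t := by
  have hst' : s.toFinset ≠ t.toFinset := fun e =>
    hxs (Multiset.mem_toFinset.1 (e ▸ Multiset.mem_toFinset.2 hxt))
  obtain ⟨p, hp, b₁, Hβ⟩ := hβ.exists_smul_rel hab hne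
  obtain ⟨q, hq, b₂, Hγ⟩ := hγ.exists_smul_rel hst hst'
  have hj : 0 < t.count x := Multiset.count_pos.2 hxt
  set k := p * q * (b₁ + b₂ + 1) with hk
  have hk0 : 0 < k := by positivity
  set n := t.count x * k with hn
  have hn0 : n ≠ 0 := by positivity
  have Hδ : ∀ w w' : Multiset ℕ, w ≠ 0 → w' ≠ 0 → δ (n • w) (n • w + n • w') := by
    intro w w' hw hw'
    refine hβδ ?_ ?_
    · have e : n = p * (t.count x * q * (b₁ + b₂ + 1)) := by rw [hn, hk]; ring
      rw [e]
      refine Hβ _ ?_ w w' hw hw'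
      have : b₁ + b₂ + 1 ≤ t.count x * q * (b₁ + b₂ + 1) :=
        Nat.le_mul_of_pos_left _ (by positivity)
      omega
    · have e : n = q * (t.count x * p * (b₁ + b₂ + 1)) := by rw [hn, hk]; ring
      rw [e]
      refine Hγ _ ?_ w w' hw hw'
      have : b₁ + b₂ + 1 ≤ t.count x * p * (b₁ + b₂ + 1) :=
        Nat.le_mul_of_pos_left _ (by positivity)
      omega
  have hs0 : s ≠ 0 := hγ.ne_zero_of_ne hst fun e => hst' (by rw [e])
  have ht0 : t ≠ 0 := hγ.ne_zero hst hs0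
  have hγs : γ s (s + n • s) := by
    have := hγ.absorbs_of_mem_right hxs hst (k • s)
    rwa [← mul_smul] at this
  have hγt : γ t (t + n • {x}) := by
    have := hγ.absorbs_of_mem_left hxs (hγ.symm hst) (k • {x})
    rwa [← mul_smul] at this
  have supp : ∀ {u v : Multiset ℕ}, v ⊆ u → (u + n • v).toFinset = u.toFinset := by
    intro u v huv
    ext c
    simp only [Multiset.toFinset_add, Finset.mem_union, Multiset.mem_toFinset,
      Multiset.mem_nsmul_of_ne_zero hn0]
    exact ⟨fun h => h.elim id (@huv c), Or.inl⟩
  have close : ∀ {u v w : Multiset ℕ}, IsZeroWord α u → v ⊆ u → v ≠ 0 → w ≠ 0 →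
      γ u (u + n • v) → δ u (u + n • v + n • w) := by
    intro u v w hu hvu hv hw huv
    refine hδ.trans (hαδ (hα.rel_of_zero hu (hα.zero_add hu _)) huv (supp hvu).symm) ?_
    have := hδ.add u (Hδ v w hv hw)
    exact hδ.trans (hδ.of_eq (add_comm _ _)) (hδ.trans this (hδ.of_eq (by abel)))
  have hw : s + t ≠ 0 := fun e => hs0 (add_eq_zero.1 e).1
  have h1 := close hs (fun _ h => h) hs0 hw hγs
  have h2 := close ht (Multiset.singleton_subset.2 hxt) (Multiset.singleton_ne_zero x) hw hγt
  refine hδ.trans h1 (hδ.trans (hαδ ?_ ?_ ?_) (hδ.symm h2))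
  · exact hα.rel_of_zero (hα.zero_add (hα.zero_add hs _) _) (hα.zero_add (hα.zero_add ht _) _)
  · exact hγ.trans (hγ.symm (hδγ h1)) (hγ.trans hst (hδγ h2))
  · ext c
    simp only [Multiset.toFinset_add, Finset.mem_union, Multiset.mem_toFinset,
      Multiset.mem_nsmul_of_ne_zero hn0, Multiset.mem_add, Multiset.mem_singleton]
    constructor
    · tauto
    · rintro ((h | rfl) | h) <;> tauto

theorem isCostandard_of_rel_imp {V : ComVariety}
    (H : ∀ (B C : ComVariety) (s t : Multiset ℕ), rel C s t →
      Relation.ReflTransGen (fun s t => rel V s t ∨ rel B s t) s t →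
        rel ((V ⊔ C) ⊓ (B ⊔ C)) s t) : IsCostandard V := by
  refine fun B C => le_antisymm (sup_le (inf_le_inf le_sup_left le_sup_left)
    (le_inf le_sup_right le_sup_right)) (le_iff_rel.2 fun s t hst => ?_)
  obtain ⟨h1, h2⟩ := rel_sup.1 hst
  exact H B C s t h2 (rel_inf.1 h1)

theorem isCostandard_of_isSmallNil {N : ComVariety} (hN : IsSmallNil (rel N)) :
    IsCostandard N := by
  refine isCostandard_of_rel_imp fun B C s t hγ hst => ?_
  have hδ := rel_isFIC ((N ⊔ C) ⊓ (B ⊔ C))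
  have hα : ∀ {s t}, rel N s t → rel C s t → rel ((N ⊔ C) ⊓ (B ⊔ C)) s t := fun h h' =>
    rel_inf_left (rel_sup.2 ⟨h, h'⟩)
  have hβ : ∀ {s t}, rel B s t → rel C s t → rel ((N ⊔ C) ⊓ (B ⊔ C)) s t := fun h h' =>
    rel_inf_right (rel_sup.2 ⟨h, h'⟩)
  have hC := rel_isFIC C
  rcases hN.rel_or_swap_or_exists_zero (rel_isFIC B) hC hst hγ with
    h | h | ⟨s', t', hs', ht', ⟨h1, h2, -⟩, h3, h4, -⟩
  · exact hβ h hγ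
  · exact hα (hN.swap h) hγ
  · exact hδ.trans (hβ h1 h2) (hδ.trans (hα (hN.rel_of_zero hs' ht')
      (hC.trans (hC.symm h2) (hC.trans hγ h4))) (hδ.symm (hβ h3 h4)))

theorem isCostandard_of_rel_iff {V N : ComVariety} (hN : IsSmallNil (rel N))
    (hV : ∀ s t, rel V s t ↔ s.toFinset = t.toFinset ∧ rel N s t) : IsCostandard V := by
  refine isCostandard_of_rel_imp fun B C s t hγ hst => ?_
  have hδ := rel_isFIC ((V ⊔ C) ⊓ (B ⊔ C))
  have hα : ∀ {s t}, rel N s t → rel C s t → s.toFinset = t.toFinset →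
      rel ((V ⊔ C) ⊓ (B ⊔ C)) s t := fun h h' hs =>
    rel_inf_left (rel_sup.2 ⟨(hV _ _).2 ⟨hs, h⟩, h'⟩)
  have hβ : ∀ {s t}, rel B s t → rel C s t → rel ((V ⊔ C) ⊓ (B ⊔ C)) s t := fun h h' =>
    rel_inf_right (rel_sup.2 ⟨h, h'⟩)
  have hγ' : ∀ {s t}, rel ((V ⊔ C) ⊓ (B ⊔ C)) s t → rel C s t := fun h =>
    le_iff_rel.1 (le_inf le_sup_right le_sup_right) _ _ h
  have hB := rel_isFIC B
  have hC := rel_isFIC C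
  rcases hN.rel_or_swap_or_exists_zero hB hC
    (Relation.ReflTransGen.mono (fun s t h => h.imp_left fun h => ((hV s t).1 h).2) _ _ hst) hγ with
    h | h | ⟨s', t', hs', ht', ⟨h1, h2, e⟩, h3, h4, e'⟩
  · exact hβ h hγ
  · exact hα (hN.swap h) hγ h.toFinset_eq
  have hst' : rel C s' t' := hC.trans (hC.symm h2) (hC.trans hγ h4)
  refine hδ.trans (hβ h1 h2) (hδ.trans ?_ (hδ.symm (hβ h3 h4)))
  by_cases hsup : s'.toFinset = t'.toFinset
  · exact hα (hN.rel_of_zero hs' ht') hst' hsup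
  obtain ⟨a, b, hab, hne⟩ : ∃ a b, rel B a b ∧ a.toFinset ≠ b.toFinset := by
    by_contra! hcon
    refine hsup (e.trans (Eq.trans ?_ e'.symm))
    clear hγ h1 h2 h3 h4 e e' hst'
    induction hst with
    | refl => rfl
    | tail _ hwt ih => exact ih.trans (hwt.elim (fun h => ((hV _ _).1 h).1) (hcon _ _))
  by_cases h5 : s'.toFinset ⊆ t'.toFinset
  · obtain ⟨x, hx⟩ := Finset.not_subset.1 fun h6 => hsup (h5.antisymm h6)
    rw [Multiset.mem_toFinset, Multiset.mem_toFinset] at hx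
    exact hN.rel_of_toFinset_ne hB hC hδ hα hβ hγ' hab hne hs' ht' hst' hx.2 hx.1
  · obtain ⟨x, hx⟩ := Finset.not_subset.1 h5
    rw [Multiset.mem_toFinset, Multiset.mem_toFinset] at hx
    exact hδ.symm
      (hN.rel_of_toFinset_ne hB hC hδ hα hβ hγ' hab hne ht' hs' (hC.symm hst') hx.2 hx.1)

/-! ### Concrete varieties -/

theorem IsFIC.absorbs_of_subset {r : Multiset ℕ → Multiset ℕ → Prop} (h : IsFIC r)
    {s : Multiset ℕ} (hs : ∀ x ∈ s, r s (s + {x})) {t : Multiset ℕ} (hts : t ⊆ s) :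
    r s (s + t) := by
  induction t using Multiset.induction_on with
  | empty => exact h.of_eq (by simp)
  | cons a t ih =>
    obtain ⟨ha, ht⟩ := Multiset.cons_subset.1 hts
    rw [← Multiset.singleton_add]
    exact h.trans (hs a ha) (h.trans (h.add {a} (ih ht)) (h.of_eq (by abel)))

theorem IsFIC.rel_of_toFinset_eq {r : Multiset ℕ → Multiset ℕ → Prop} (h : IsFIC r)
    {s t : Multiset ℕ} (hs : ∀ x ∈ s, r s (s + {x})) (ht : ∀ x ∈ t, r t (t + {x}))
    (e : s.toFinset = t.toFinset) : r s t := by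
  have hmem : ∀ x, x ∈ s ↔ x ∈ t := fun x => by
    rw [← Multiset.mem_toFinset, e, Multiset.mem_toFinset]
  refine h.trans (h.absorbs_of_subset hs fun x hx => (hmem x).2 hx) ?_
  rw [add_comm]
  exact h.symm (h.absorbs_of_subset ht fun x hx => (hmem x).1 hx)

theorem isFIC_toFinset : IsFIC fun s t : Multiset ℕ => s.toFinset = t.toFinset where
  refl _ := rfl
  symm h := h.symm
  trans h h' := h.trans h'
  add c h := by rw [Multiset.toFinset_add, Multiset.toFinset_add, h]
  subst {s t} σ hσ h := by
    have hmem : ∀ x, x ∈ s ↔ x ∈ t := fun x => by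
      rw [← Multiset.mem_toFinset, h, Multiset.mem_toFinset]
    ext x
    simp [hmem]
  ne_zero {s t} h hs ht := by
    subst ht
    exact hs (Multiset.toFinset_eq_empty.1 h)

theorem rel_SLcom {s t : Multiset ℕ} : rel SLcom s t ↔ s.toFinset = t.toFinset := by
  constructor
  · intro h
    refine (rel_ofRel isFIC_toFinset).1 (le_iff_rel.1 ?_ s t h)
    change eqTh _ ⊆ _
    rw [← (ofRel _ isFIC_toFinset).1.closed]
    refine eqTh_mono ?_
    rintro e (rfl | rfl)
    · exact (ofRel _ isFIC_toFinset).2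
    · change (content _).toFinset = (content _).toFinset
      simp [xw]
  · have hr := rel_isFIC SLcom
    have h0 : rel SLcom ({0} + {0}) {0} := by
      have : ((xw * xw, xw) : SgId) ∈ SLcom.1.th := subset_eqTh _ (by simp)
      simpa [xw] using rel_content.2 this
    have habs : ∀ u : Multiset ℕ, ∀ x ∈ u, rel SLcom u (u + {x}) := by
      intro u x hx
      obtain ⟨v, rfl⟩ := Multiset.exists_cons_of_mem hx
      have h1 := hr.add v (hr.symm (hr.map (fun _ => x) h0))
      simp only [Multiset.map_singleton, Multiset.singleton_add] at h1 ⊢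
      exact hr.trans h1 (hr.of_eq (by simp [add_comm]))
    exact hr.rel_of_toFinset_eq (habs s) (habs t)

theorem Tcom_le (V : ComVariety) : Tcom ≤ V := by
  change V.1.th ⊆ eqTh Set.univ
  exact (Set.subset_univ _).trans (subset_eqTh _)

theorem le_COMcom (V : ComVariety) : V ≤ COMcom := by
  change eqTh {commId} ⊆ V.1.th
  rw [← V.1.closed]
  exact eqTh_mono (Set.singleton_subset_iff.2 V.2)

theorem exists_rel_of_ne_COMcom {V : ComVariety} (h : V ≠ COMcom) : ∃ s t, rel V s t ∧ s ≠ t := by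
  by_contra! hcon
  exact h (le_antisymm (le_COMcom V)
    (le_iff_rel.2 fun s t hst => hcon s t hst ▸ Or.inl rfl))

theorem vSatZero_iff {V : ComVariety} :
    VSatZero V.1 w_xxyz ↔ rel V (content w_xxyz) (content w_xxyz + {3}) := by
  have e : content w_xxyz + {3} = content (w_xxyz * FreeSemigroup.of 3) := by simp
  rw [e, rel_content]
  constructor
  · exact fun h => mem_th_of_models fun S _ hS σ => by
      simpa using (h S hS σ (σ 3)).1.symm
  · intro h S _ hS σ a
    have h' : (w_xxyz, FreeSemigroup.of 3 * w_xxyz) ∈ V.1.th :=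
      th_trans h (mem_th_of_content_eq V (by simp [add_comm]))
    have h1 := hS _ h fun i => if i = 3 then a else σ i
    have h2 := hS _ h' fun i => if i = 3 then a else σ i
    simp only [w_xxyz, xw, yw, zw, map_mul, FreeSemigroup.lift_of] at h1 h2 ⊢
    exact ⟨h1.symm, h2.symm⟩

theorem idQ_mem_iff {V : ComVariety} :
    idQ ∈ V.1.th ↔ rel V (2 • {0} + {1}) ({0} + 2 • {1}) := by
  have e1 : (2 • {0} + {1} : Multiset ℕ) = content w_xxy := by
    simp [w_xxy, xw, yw, two_smul]
  have e2 : ({0} + 2 • {1} : Multiset ℕ) = content w_xyy := by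
    simp only [w_xyy, xw, yw, content_mul, content_of]
    module
  rw [e1, e2, rel_content]
  rfl

theorem IsLong.exists_eq {s : Multiset ℕ} (h : IsLong s) {x : ℕ} (hx : x ∈ s) :
    ∃ a b c, c ≠ 0 ∧ s = 2 • {a} + {b} + c ∧ (x = a ∨ x = b) := by
  obtain ⟨a, t, rfl⟩ := exists_eq_two_smul_add h.2
  have hc : 2 ≤ t.card := by
    have := h.1
    simp only [Multiset.card_add, Multiset.card_nsmul, Multiset.card_singleton] at this
    omega
  obtain ⟨b, hb, hxb⟩ : ∃ b ∈ t, x = a ∨ x = b := by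
    by_cases hxa : x = a
    · obtain ⟨b, hb⟩ := Multiset.card_pos_iff_exists_mem.1 (two_pos.trans_le hc)
      exact ⟨b, hb, Or.inl hxa⟩
    · refine ⟨x, (Multiset.mem_add.1 hx).resolve_left fun h => hxa ?_, Or.inr rfl⟩
      exact Multiset.mem_singleton.1 (Multiset.mem_of_mem_nsmul h)
  obtain ⟨c, rfl⟩ := Multiset.exists_cons_of_mem hb
  refine ⟨a, b, c, ?_, by rw [← Multiset.singleton_add, add_assoc], hxb⟩
  rintro rfl
  simp at hc

theorem IsFIC.swap_of_idQ {r : Multiset ℕ → Multiset ℕ → Prop} (h : IsFIC r)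
    (hq : r (2 • {0} + {1}) ({0} + 2 • {1})) {s t : Multiset ℕ} (hs : s ≠ 0) (ht : t ≠ 0) :
    r (2 • s + t) (s + 2 • t) := by
  have := h.subst_two (p := 2) (q := 1) (p' := 1) (q' := 2) zero_ne_one hs ht
    (by simpa only [one_smul] using hq)
  simpa only [one_smul] using this

theorem isSmallNil_of_vSatZero {N : ComVariety} (h0 : VSatZero N.1 w_xxyz)
    (hq : idQ ∈ N.1.th) : IsSmallNil (rel N) := by
  have hN := rel_isFIC N
  rw [vSatZero_iff] at h0
  have habs : ∀ {s t : Multiset ℕ}, IsLong s → t ≠ 0 → rel N s (s + t) := by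
    intro s t hs ht
    obtain ⟨x, hx⟩ := Multiset.exists_mem_of_ne_zero hs.ne_zero
    obtain ⟨a, b, c, hc, rfl, -⟩ := hs.exists_eq hx
    have := hN.subst (fun i => if i = 0 then {a} else if i = 1 then {b} else if i = 2 then c else t)
      (by intro i; split_ifs <;> first | assumption | simp) h0
    simp only [w_xxyz, xw, yw, zw, content_mul, content_of, Multiset.add_bind,
      Multiset.singleton_bind, reduceIte, one_ne_zero, OfNat.ofNat_ne_zero,
      OfNat.ofNat_ne_one, Nat.reduceEqDiff] at this
    rwa [two_smul]
  refine { hN with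
    long := fun {s t} hs ht => hN.trans (habs hs ht.ne_zero) ?_
    swap := ?_ }
  · rw [add_comm]
    exact hN.symm (habs ht hs.ne_zero)
  · rintro s t ⟨a, b, rfl, rfl⟩
    exact hN.swap_of_idQ (idQ_mem_iff.1 hq) (Multiset.singleton_ne_zero a)
      (Multiset.singleton_ne_zero b)

theorem isCostandard_of_eq_sup {V M N : ComVariety} (hM : M = Tcom ∨ M = SLcom)
    (h0 : VSatZero N.1 w_xxyz) (hq : idQ ∈ N.1.th) (hV : V = M ⊔ N) : IsCostandard V := by
  have hN := isSmallNil_of_vSatZero h0 hq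
  subst hV
  rcases hM with rfl | rfl
  · rw [sup_eq_right.2 (Tcom_le N)]
    exact isCostandard_of_isSmallNil hN
  · exact isCostandard_of_rel_iff hN fun s t => by rw [rel_sup, rel_SLcom]

theorem isCostandard_COMcom : IsCostandard COMcom := fun B C => by
  rw [inf_eq_right.2 (le_COMcom B), sup_eq_left.2 (le_COMcom C), inf_eq_right.2 (le_COMcom _)]

theorem _root_.IsCostandard.isModularElt {L : Type*} [Lattice L] {a : L} (h : IsCostandard a) :
    IsModularElt a := fun b c hbc => by
  rw [h c b, sup_eq_left.2 hbc]

theorem _root_.IsCostandard.isUpperModular {L : Type*} [Lattice L] {a : L} (h : IsCostandard a) :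
    IsUpperModular a := fun b c hba => by
  rw [sup_comm b (a ⊓ c), h c b, sup_eq_left.2 hba, sup_comm b c]

/-! ### Commutative varieties satisfying `x²y = xy²` -/

theorem IsFIC.absorbs_of_idQ {r : Multiset ℕ → Multiset ℕ → Prop} (h : IsFIC r)
    (hq : r (2 • {0} + {1}) ({0} + 2 • {1})) {a b c : Multiset ℕ} (ha : a ≠ 0) (hb : b ≠ 0)
    (hc : c ≠ 0) :
    r (2 • a + b + c) (2 • a + b + c + a) ∧ r (2 • a + b + c) (2 • a + b + c + b) := by
  have hab : r (2 • a + b + c) (a + 2 • b + c) := h.add c (h.swap_of_idQ hq ha hb)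
  have hac : r (2 • a + b + c) (a + b + 2 • c) :=
    h.trans (h.of_eq (by module)) (h.trans (h.add b (h.swap_of_idQ hq ha hc)) (h.of_eq (by module)))
  have hcab : r (a + b + 2 • c) (2 • a + b + c + b) :=
    h.trans (h.of_eq (by module)) (h.trans (h.swap_of_idQ hq hc (t := a + b)
      fun e => ha (add_eq_zero.1 e).1) (h.of_eq (by module)))
  have hB := h.trans hac hcab
  exact ⟨h.trans hB (h.trans (h.of_eq (by module)) (h.add a (h.symm hab))), hB⟩

theorem IsFIC.rel_of_isLong_of_idQ {r : Multiset ℕ → Multiset ℕ → Prop} (h : IsFIC r)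
    (hq : r (2 • {0} + {1}) ({0} + 2 • {1})) {s t : Multiset ℕ} (hs : IsLong s) (ht : IsLong t)
    (e : s.toFinset = t.toFinset) : r s t := by
  have habs : ∀ {s : Multiset ℕ}, IsLong s → ∀ x ∈ s, r s (s + {x}) := by
    intro s hs x hx
    obtain ⟨a, b, c, hc, rfl, hx'⟩ := hs.exists_eq hx
    have := h.absorbs_of_idQ hq (Multiset.singleton_ne_zero a) (Multiset.singleton_ne_zero b) hc
    rcases hx' with rfl | rfl
    exacts [this.1, this.2]
  exact h.rel_of_toFinset_eq (habs hs) (habs ht) e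

theorem isFIC_isLong : IsFIC fun s t => s = t ∨ IsLong s ∧ IsLong t where
  refl _ := Or.inl rfl
  symm h := h.imp Eq.symm And.symm
  trans := by
    rintro s t u (rfl | h) (rfl | h')
    exacts [Or.inl rfl, Or.inr h', Or.inr h, Or.inr ⟨h.1, h'.2⟩]
  add c h := h.imp (congrArg (· + c)) fun h => ⟨h.1.add c, h.2.add c⟩
  subst σ hσ h := h.imp (congrArg (Multiset.bind · σ)) fun h => ⟨h.1.bind hσ, h.2.bind hσ⟩
  ne_zero := by
    rintro s t (rfl | h) hs
    exacts [hs, h.2.ne_zero]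

theorem isLong_content_w_xxyz : IsLong (content w_xxyz) := by
  unfold IsLong w_xxyz xw yw zw
  simp only [content_mul, content_of]
  decide

theorem vSatZero_of_toFinset_ne {V : ComVariety} (hq : idQ ∈ V.1.th) {a b : Multiset ℕ}
    (hab : rel V a b) (hne : a.toFinset ≠ b.toFinset) : VSatZero V.1 w_xxyz := by
  have hr := rel_isFIC V
  rw [idQ_mem_iff] at hq
  obtain ⟨p, hp, q, H⟩ := hr.exists_smul_rel hab hne
  rw [vSatZero_iff]
  have hW := isLong_content_w_xxyz
  set w := content w_xxyz
  set n := p * (q + 1) with hn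
  have hn0 : n ≠ 0 := by positivity
  have hJ : ∀ {s t : Multiset ℕ}, IsLong s → IsLong t → s.toFinset = t.toFinset → rel V s t :=
    hr.rel_of_isLong_of_idQ hq
  refine hr.trans (hJ (t := w + n • w) hW (hW.add _) ?_) (hr.trans (t := w + n • w + n • {3}) ?_
    (hJ ((hW.add _).add _) (hW.add _) ?_))
  · simp [Multiset.toFinset_nsmul _ _ hn0]
  · have := hr.add w (H (q + 1) (Nat.lt_succ_self q) w {3} hW.ne_zero (Multiset.singleton_ne_zero 3))
    rw [← hn] at this
    exact hr.trans (hr.of_eq (by module)) (hr.trans this (hr.of_eq (by module)))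
  · simp [Multiset.toFinset_nsmul _ _ hn0]

theorem exists_eq_sup_of_idQ {V : ComVariety} (hq : idQ ∈ V.1.th) :
    ∃ M N : ComVariety, (M = Tcom ∨ M = SLcom) ∧
      VSatZero N.1 w_xxyz ∧ idQ ∈ N.1.th ∧ V = M ⊔ N := by
  by_cases hσ : ∃ a b, rel V a b ∧ a.toFinset ≠ b.toFinset
  · obtain ⟨a, b, hab, hne⟩ := hσ
    exact ⟨Tcom, V, Or.inl rfl, vSatZero_of_toFinset_ne hq hab hne, hq,
      (sup_eq_right.2 (Tcom_le V)).symm⟩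
  push Not at hσ
  have hr := rel_isFIC V
  refine ⟨SLcom, V ⊓ ofRel _ isFIC_isLong, Or.inr rfl, vSatZero_iff.2 (rel_inf_right
    ((rel_ofRel _).2 (Or.inr ⟨isLong_content_w_xxyz, isLong_content_w_xxyz.add _⟩))),
    idQ_mem_iff.2 (rel_inf_left (idQ_mem_iff.1 hq)), eq_of_rel_iff fun s t => ?_⟩
  rw [rel_sup, rel_SLcom]
  refine ⟨fun h => ⟨hσ s t h, rel_inf_left h⟩, ?_⟩
  rintro ⟨e, h⟩
  have key : rel V s t ∨ ∃ a b, IsLong a ∧ IsLong b ∧ rel V s a ∧ rel V t b := by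
    replace h := rel_inf.1 h
    clear e
    induction h with
    | refl => exact Or.inl (hr.refl s)
    | @tail u v _ huv ih =>
      rcases huv with huv | huv
      · exact ih.imp (fun h => hr.trans h huv) fun ⟨a, b, ha, hb, h1, h2⟩ =>
          ⟨a, b, ha, hb, h1, hr.trans (hr.symm huv) h2⟩
      · rcases (rel_ofRel isFIC_isLong).1 huv with rfl | ⟨hu, hv⟩
        · exact ih
        · rcases ih with h | ⟨a, b, ha, hb, h1, h2⟩
          · exact Or.inr ⟨u, v, hu, hv, h, hr.refl v⟩
          · exact Or.inr ⟨a, v, ha, hv, h1, hr.refl v⟩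
  rcases key with h | ⟨a, b, ha, hb, h1, h2⟩
  · exact h
  · exact hr.trans h1 (hr.trans (hr.rel_of_isLong_of_idQ (idQ_mem_iff.1 hq) ha hb
      ((hσ _ _ h1).symm.trans (e.trans (hσ _ _ h2)))) (hr.symm h2))

/-! ### Modular and upper-modular commutative varieties -/

theorem IsSwap.card_eq {s t : Multiset ℕ} (h : IsSwap s t) : s.card = 3 ∧ t.card = 3 := by
  obtain ⟨a, b, rfl, rfl⟩ := h
  simp

theorem IsSwap.bind {s t : Multiset ℕ} (h : IsSwap s t) {σ : ℕ → Multiset ℕ}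
    (hσ : ∀ i, σ i ≠ 0) :
    IsSwap (s.bind σ) (t.bind σ) ∨ 4 ≤ (s.bind σ).card ∧ 4 ≤ (t.bind σ).card := by
  obtain ⟨a, b, rfl, rfl⟩ := h
  have ha := Multiset.card_pos.2 (hσ a)
  have hb := Multiset.card_pos.2 (hσ b)
  simp only [two_smul, Multiset.add_bind, Multiset.singleton_bind, Multiset.card_add]
  by_cases hc : (σ a).card = 1 ∧ (σ b).card = 1
  · obtain ⟨x, hx⟩ := Multiset.card_eq_one.1 hc.1
    obtain ⟨y, hy⟩ := Multiset.card_eq_one.1 hc.2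
    exact Or.inl ⟨x, y, by rw [hx, hy, two_smul], by rw [hx, hy, two_smul]⟩
  · right
    omega

theorem isFIC_four_le_card :
    IsFIC fun s t : Multiset ℕ => s = t ∨ 4 ≤ s.card ∧ 4 ≤ t.card where
  refl _ := Or.inl rfl
  symm h := h.imp Eq.symm And.symm
  trans := by
    rintro s t u (rfl | h) (rfl | h')
    exacts [Or.inl rfl, Or.inr h', Or.inr h, Or.inr ⟨h.1, h'.2⟩]
  add c h := h.imp (congrArg (· + c)) fun h => by
    simp only [Multiset.card_add]
    omega
  subst σ hσ h := h.imp (congrArg (Multiset.bind · σ)) fun h =>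
    ⟨h.1.trans (card_le_card_bind hσ), h.2.trans (card_le_card_bind hσ)⟩
  ne_zero := by
    rintro s t (rfl | h) hs
    · exact hs
    · rintro rfl
      simp at h

theorem isFIC_swap_or_four_le_card :
    IsFIC fun s t : Multiset ℕ => s = t ∨ IsSwap s t ∨ 4 ≤ s.card ∧ 4 ≤ t.card where
  refl _ := Or.inl rfl
  symm h := h.imp Eq.symm (Or.imp IsSwap.symm And.symm)
  trans := by
    rintro s t u (rfl | h | h) (rfl | h' | h')
    · exact Or.inl rfl
    · exact Or.inr (Or.inl h')
    · exact Or.inr (Or.inr h')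
    · exact Or.inr (Or.inl h)
    · exact Or.inl (h.symm.unique h')
    · have := h.card_eq
      omega
    · exact Or.inr (Or.inr h)
    · have := h'.card_eq
      omega
    · exact Or.inr (Or.inr ⟨h.1, h'.2⟩)
  add := by
    rintro s t c (rfl | h | h)
    · exact Or.inl rfl
    · by_cases hc : c = 0
      · subst hc
        simpa only [add_zero] using Or.inr (Or.inl h)
      · have := h.card_eq
        have := Multiset.card_pos.2 hc
        simp only [Multiset.card_add]
        omega
    · simp only [Multiset.card_add]
      omega
  subst := by
    rintro s t σ hσ (rfl | h | h)
    · exact Or.inl rfl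
    · exact Or.inr (h.bind hσ)
    · exact Or.inr (Or.inr ⟨h.1.trans (card_le_card_bind hσ), h.2.trans (card_le_card_bind hσ)⟩)
  ne_zero := by
    rintro s t (rfl | h | h) hs
    · exact hs
    · rintro rfl
      simpa using h.card_eq.2
    · rintro rfl
      simp at h

/-- The commutative words with the same value in every abelian group of exponent `d`. -/
def ModRel (d : ℕ) (s t : Multiset ℕ) : Prop :=
  (s = 0 ↔ t = 0) ∧ ∀ f : ℕ → ZMod d, (s.map f).sum = (t.map f).sum

theorem isFIC_modRel (d : ℕ) : IsFIC (ModRel d) where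
  refl _ := ⟨Iff.rfl, fun _ => rfl⟩
  symm h := ⟨h.1.symm, fun f => (h.2 f).symm⟩
  trans h h' := ⟨h.1.trans h'.1, fun f => (h.2 f).trans (h'.2 f)⟩
  add c h := ⟨by simp only [add_eq_zero, h.1], fun f => by
    simp only [Multiset.map_add, Multiset.sum_add, h.2 f]⟩
  subst {s t} σ hσ h := by
    have h0 : ∀ u : Multiset ℕ, u.bind σ = 0 ↔ u = 0 := fun u => by
      refine ⟨fun hu => Multiset.card_eq_zero.1 ?_, fun hu => by simp [hu]⟩
      have := card_le_card_bind (s := u) hσ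
      rw [hu] at this
      simpa using this
    refine ⟨by rw [h0, h0, h.1], fun f => ?_⟩
    simp only [Multiset.map_bind, Multiset.sum_bind, h.2]
  ne_zero h hs := fun ht => hs (h.1.2 ht)

theorem eq_of_reflTransGen_of_isolated {ι : Type*} {r : ι → ι → Prop} {s t : ι}
    (h : ∀ w, r s w → w = s) (hst : Relation.ReflTransGen r s t) : t = s := by
  induction hst with
  | refl => rfl
  | tail _ hwt ih => exact h _ (ih ▸ hwt)

theorem _root_.IsModularElt.eq_of_rel {V : ComVariety} (hV : IsModularElt V) {x y : ℕ} (hxy : x ≠ y)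
    (hne : ¬ rel V (2 • {x} + {y}) ({x} + 2 • {y})) {w : Multiset ℕ}
    (hw : rel V (2 • {x} + {y}) w) : w = 2 • {x} + {y} := by
  have hr := rel_isFIC V
  by_contra hwne
  obtain ⟨p, hp, h1⟩ := hr.exists_absorbs_of_square_mul hxy (Ne.symm hwne)
    (fun e => hne (e ▸ hw)) hw
  have hsw : IsSwap (2 • {x} + {y}) ({x} + 2 • {y}) := ⟨x, y, rfl, rfl⟩
  have h2 : rel V ({x} + 2 • {y}) ({x} + 2 • {y} + p • {y}) := by
    have := hr.map (Equiv.swap x y) h1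
    simp only [Multiset.map_add, Multiset.map_nsmul, Multiset.map_singleton,
      Equiv.swap_apply_left, Equiv.swap_apply_right] at this
    exact hr.trans (hr.of_eq (by module)) (hr.trans this (hr.of_eq (by module)))
  set B := ofRel _ isFIC_swap_or_four_le_card
  set C := ofRel _ isFIC_four_le_card
  have hBC : B ≤ C := le_iff_rel.2 fun s t h =>
    (rel_ofRel _).2 (((rel_ofRel isFIC_four_le_card).1 h).imp_right Or.inr)
  have key : rel ((V ⊓ C) ⊔ B) (2 • {x} + {y}) ({x} + 2 • {y}) := by
    refine rel_sup.2 ⟨?_, (rel_ofRel _).2 (Or.inr (Or.inl hsw))⟩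
    have hJ := rel_isFIC (V ⊓ C)
    refine hJ.trans (rel_inf_left h1) (hJ.trans (rel_inf_right ((rel_ofRel _).2 (Or.inr ?_)))
      (hJ.symm (rel_inf_left h2)))
    simp
    omega
  rw [← hV B C hBC, rel_inf] at key
  refine hne (hr.of_eq (eq_of_reflTransGen_of_isolated ?_ key).symm)
  have hc := hsw.card_eq.1
  rintro u (h | h)
  · obtain ⟨h1, h2⟩ := rel_sup.1 h
    rcases (rel_ofRel isFIC_swap_or_four_le_card).1 h2 with h2 | h2 | h2
    · exact h2.symm
    · exact absurd h1 (h2.unique hsw ▸ hne)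
    · omega
  · rcases (rel_ofRel isFIC_four_le_card).1 h with h2 | h2
    · exact h2.symm
    · omega

theorem IsFIC.exists_smul_ne {r : Multiset ℕ → Multiset ℕ → Prop} (h : IsFIC r)
    {s t : Multiset ℕ} (hst : r s t) (hne : s ≠ t) :
    ∃ p q : ℕ, p ≠ q ∧ ∀ x : ℕ, r (p • {x}) (q • {x}) := by
  by_cases hc : s.card = t.card
  · obtain ⟨a, ha⟩ : ∃ a, s.count a ≠ t.count a := by
      by_contra! hcon
      exact hne (Multiset.ext.2 hcon)
    refine ⟨2 * s.count a + s.countP (· ≠ a), 2 * t.count a + t.countP (· ≠ a), ?_, fun x => ?_⟩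
    · have h1 := s.card_eq_countP_add_countP (a = ·)
      have h2 := t.card_eq_countP_add_countP (a = ·)
      simp only [Multiset.count, ne_eq, eq_comm (b := a)] at ha h1 h2 ⊢
      omega
    · have := h.subst (fun i => if i = a then 2 • {x} else {x})
        (by intro i; split_ifs <;> simp) hst
      rw [bind_collapse, bind_collapse] at this
      exact h.trans (h.of_eq (by module)) (h.trans this (h.of_eq (by module)))
  · refine ⟨s.card, t.card, hc, fun x => ?_⟩
    have := h.map (fun _ => x) hst
    rwa [Multiset.map_const', Multiset.map_const', ← Multiset.nsmul_singleton,
      ← Multiset.nsmul_singleton] at this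

theorem IsFIC.exists_periodic {r : Multiset ℕ → Multiset ℕ → Prop} (h : IsFIC r)
    {s t : Multiset ℕ} (hst : r s t) (hne : s ≠ t) :
    ∃ n m : ℕ, 0 < m ∧ ∀ k x : ℕ, n ≤ k → r (k • {x}) ((k + m) • {x}) := by
  have key : ∀ {p q : ℕ}, p < q → (∀ x : ℕ, r (p • {x}) (q • {x})) →
      ∃ n m : ℕ, 0 < m ∧ ∀ k x : ℕ, n ≤ k → r (k • {x}) ((k + m) • {x}) := by
    intro p q hpq H
    refine ⟨p, q - p, by omega, fun k x hk => ?_⟩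
    obtain ⟨l, rfl⟩ := Nat.exists_eq_add_of_le hk
    have := h.add (l • {x}) (H x)
    rw [← add_smul, ← add_smul] at this
    rwa [show p + l + (q - p) = q + l by omega]
  obtain ⟨p, q, hpq, H⟩ := h.exists_smul_ne hst hne
  rcases hpq.lt_or_gt with hlt | hlt
  · exact key hlt H
  · exact key hlt fun x => h.symm (H x)

theorem idQ_mem_of_isModularElt_of_isUpperModular {V : ComVariety} (hm : IsModularElt V)
    (hu : IsUpperModular V) (hV : V ≠ COMcom) : idQ ∈ V.1.th := by
  rw [idQ_mem_iff]
  by_contra hne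
  have hr := rel_isFIC V
  obtain ⟨s, t, hst, hst'⟩ := exists_rel_of_ne_COMcom hV
  obtain ⟨n, m, hm0, H⟩ := hr.exists_periodic hst hst'
  set u : Multiset ℕ := 2 • {0} + {1} with hu'
  set v : Multiset ℕ := {0} + 2 • {1} with hv'
  have hsw : IsSwap u v := ⟨0, 1, rfl, rfl⟩
  have isoU : ∀ w, rel V u w → w = u := fun w hw => hm.eq_of_rel zero_ne_one hne hw
  have isoV : ∀ w, rel V v w → w = v := fun w hw => by
    have e : v = 2 • {1} + {0} := add_comm _ _
    rw [e] at hw ⊢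
    refine hm.eq_of_rel one_ne_zero (fun h => hne ?_) hw
    exact hr.trans (hr.of_eq (by module)) (hr.trans (hr.symm h) (hr.of_eq (by module)))
  set B := V ⊓ ofRel _ isFIC_swap_or_four_le_card
  set C := ofRel _ (isFIC_modRel (m + 1))
  have hB : ∀ w, rel B u w → w = u ∨ w = v := by
    intro w hw
    have := rel_inf.1 hw
    clear hw
    induction this with
    | refl => exact Or.inl rfl
    | tail _ hwt ih =>
      rcases hwt with hwt | hwt
      · rcases ih with rfl | rfl
        · exact Or.inl (isoU _ hwt)
        · exact Or.inr (isoV _ hwt)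
      · rcases (rel_ofRel isFIC_swap_or_four_le_card).1 hwt with rfl | hwt | hwt
        · exact ih
        · rcases ih with rfl | rfl
          · exact Or.inr (hwt.unique hsw)
          · exact Or.inl (hwt.unique hsw.symm)
        · have := hsw.card_eq
          rcases ih with rfl | rfl <;> omega
  have key : rel (B ⊔ (V ⊓ C)) u v := by
    refine rel_sup.2 ⟨rel_inf_right ((rel_ofRel _).2 (Or.inr (Or.inl hsw))), ?_⟩
    have hJ := rel_isFIC (V ⊓ C)
    set p := 2 + (m + 1) * n with hp
    have hnp : n ≤ p := by nlinarith
    have hpm : ((p : ℕ) : ZMod (m + 1)) = 2 := by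
      have := ZMod.natCast_self (m + 1)
      rw [hp, Nat.cast_add, Nat.cast_mul, this]
      simp
    have hqm : ((p + m : ℕ) : ZMod (m + 1)) = 1 := by
      have := ZMod.natCast_self (m + 1)
      rw [Nat.cast_add, hpm]
      push_cast at this
      linear_combination this
    have h1 : rel C u (p • {0} + (p + m) • {1}) := by
      refine (rel_ofRel _).2 ⟨?_, fun f => ?_⟩
      · simp [hu', hp]
      · simp only [hu', Multiset.map_add, Multiset.map_nsmul, Multiset.map_singleton,
          Multiset.sum_add, Multiset.sum_nsmul, Multiset.sum_singleton, nsmul_eq_mul, hpm, hqm]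
        simp
    have h2 : rel C v ((p + m) • {0} + p • {1}) := by
      refine (rel_ofRel _).2 ⟨?_, fun f => ?_⟩
      · simp [hv', hp]
      · simp only [hv', Multiset.map_add, Multiset.map_nsmul, Multiset.map_singleton,
          Multiset.sum_add, Multiset.sum_nsmul, Multiset.sum_singleton, nsmul_eq_mul, hpm, hqm]
        simp
    have h3 : rel V (p • {0} + (p + m) • {1}) ((p + m) • {0} + p • {1}) := by
      refine hr.trans (hr.add _ (H p 0 hnp)) ?_
      rw [add_comm, add_comm _ (p • {1})]
      exact hr.add _ (hr.symm (H p 1 hnp))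
    exact hJ.trans (rel_inf_right h1) (hJ.trans (rel_inf_left h3) (hJ.symm (rel_inf_right h2)))
  rw [← hu B C inf_le_left, rel_inf] at key
  refine hne (hr.of_eq (eq_of_reflTransGen_of_isolated ?_ key).symm)
  rintro w (h | h)
  · exact isoU w h
  obtain ⟨h1, h2⟩ := rel_sup.1 h
  refine (hB w h1).resolve_right ?_
  rintro rfl
  have h3 := ((rel_ofRel (isFIC_modRel (m + 1))).1 h2).2 fun i => if i = 0 then 1 else 0
  have : Fact (1 < m + 1) := ⟨by omega⟩
  simp only [hu', hv', Multiset.map_add, Multiset.map_nsmul, Multiset.map_singleton,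
    Multiset.sum_add, Multiset.sum_nsmul, Multiset.sum_singleton, reduceIte, one_ne_zero] at h3
  simp [two_smul] at h3

end ComVariety

/-- Theorem 2 of the paper.  For a commutative semigroup
variety `V`: (a) `V` is a modular and upper-modular element of **Com** ⟺
(b) `V` is a costandard element of **Com** ⟺ (c) `V = COM`, or `V = M ∨ N`
with `M ∈ {T, SL}` and `N` a commutative variety satisfying `x²yz = 0`
and `x²y = xy²`. -/
theorem costandard_iff (V : ComVariety) :
    ((IsModularElt V ∧ IsUpperModular V) ↔ IsCostandard V) ∧
    (IsCostandard V ↔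
      (V = COMcom ∨
        ∃ M N : ComVariety, (M = Tcom ∨ M = SLcom) ∧
          VSatZero N.1 w_xxyz ∧ idQ ∈ N.1.th ∧ V = M ⊔ N)) := by
  have hcb : (V = COMcom ∨ ∃ M N : ComVariety, (M = Tcom ∨ M = SLcom) ∧
      VSatZero N.1 w_xxyz ∧ idQ ∈ N.1.th ∧ V = M ⊔ N) → IsCostandard V := by
    rintro (rfl | ⟨M, N, hM, h0, hq, hV⟩)
    · exact ComVariety.isCostandard_COMcom
    · exact ComVariety.isCostandard_of_eq_sup hM h0 hq hV
  have hac : IsModularElt V ∧ IsUpperModular V → (V = COMcom ∨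
      ∃ M N : ComVariety, (M = Tcom ∨ M = SLcom) ∧
        VSatZero N.1 w_xxyz ∧ idQ ∈ N.1.th ∧ V = M ⊔ N) := fun ⟨hm, hu⟩ =>
    or_iff_not_imp_left.2 fun hV => ComVariety.exists_eq_sup_of_idQ
      (ComVariety.idQ_mem_of_isModularElt_of_isUpperModular hm hu hV)
  have hba : IsCostandard V → IsModularElt V ∧ IsUpperModular V := fun h =>
    ⟨h.isModularElt, h.isUpperModular⟩
  exact ⟨⟨fun h => hcb (hac h), hba⟩, fun h => hac (hba h), hcb⟩
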